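/- arXiv:1602.06208 — 4 statements merged into one kernel-verified Lean document; each statement's English description precedes it below -/
import Mathlib

section
/- For every integer base g ≥ 5, every positive integer can be written as a sum of three palindromes in base g (where 0 is counted as a palindrome). -/
def IsBasePalindrome (g n : ℕ) : Prop := Nat.digits g n = (Nat.digits g n).reverse

/-- `n` is written in base `g` by a palindromic string of `k` digits, leading zeros allowed. -/
def PalString (g k n : ℕ) : Prop :=
  ∃ l : List ℕ, l.length = k ∧ (∀ d ∈ l, d < g) ∧ l.reverse = l ∧ Nat.ofDigits g l = n

/-- `n` is a sum of three base `g` palindromes. -/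
def IsSumThreePalindromes (g n : ℕ) : Prop :=
  ∃ a b c : ℕ, IsBasePalindrome g a ∧ IsBasePalindrome g b ∧ IsBasePalindrome g c ∧ n = a + b + c

/-- `n` is a sum of palindromic strings of lengths `k + 2`, `k + 1` and `k`. -/
def IsStaggeredSum (g k n : ℕ) : Prop :=
  ∃ X Y Z : ℕ, PalString g (k + 2) X ∧ PalString g (k + 1) Y ∧ PalString g k Z ∧ n = X + Y + Z

/-- `n` is a sum of palindromic strings of lengths `k + 1`, `k + 1` and `k`, the first of which is
shifted by one place. -/
def IsShiftedSum (g k n : ℕ) : Prop :=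
  ∃ X Y Z : ℕ, PalString g (k + 1) X ∧ PalString g (k + 1) Y ∧ PalString g k Z ∧ n = g * X + Y + Z

theorem palString_zero (g : ℕ) : PalString g 0 0 := ⟨[], by simp⟩

theorem palString_one {g d : ℕ} (hd : d < g) : PalString g 1 d := ⟨[d], by simp [hd]⟩

theorem PalString.wrap {g k m d : ℕ} (h : PalString g k m) (hd : d < g) :
    PalString g (k + 2) (d * (g ^ (k + 1) + 1) + g * m) := by
  obtain ⟨l, rfl, hl, hr, rfl⟩ := h
  refine ⟨d :: (l ++ [d]), by simp, ?_, by simp [hr], ?_⟩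
  · intro e he
    simp only [List.mem_cons, List.mem_append, List.not_mem_nil, or_false] at he
    rcases he with rfl | he | rfl
    exacts [hd, hl e he, hd]
  · rw [Nat.ofDigits_cons, Nat.ofDigits_append, Nat.ofDigits_singleton]
    ring

theorem PalString.isBasePalindrome_wrap {g k m d : ℕ} (h : PalString g k m) (hd : d < g)
    (hd0 : 0 < d) (hg : 1 < g) : IsBasePalindrome g (d * (g ^ (k + 1) + 1) + g * m) := by
  obtain ⟨l, rfl, hl, hr, rfl⟩ := h
  have key : Nat.digits g (Nat.ofDigits g (d :: (l ++ [d]))) = d :: (l ++ [d]) := by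
    refine Nat.digits_ofDigits g hg _ ?_ ?_
    · intro e he
      simp only [List.mem_cons, List.mem_append, List.not_mem_nil, or_false] at he
      rcases he with rfl | he | rfl
      exacts [hd, hl e he, hd]
    · intro _
      simp only [← List.cons_append, List.getLast_append_singleton]
      omega
  have hval : Nat.ofDigits g (d :: (l ++ [d])) =
      d * (g ^ (l.length + 1) + 1) + g * Nat.ofDigits g l := by
    rw [Nat.ofDigits_cons, Nat.ofDigits_append, Nat.ofDigits_singleton]
    ring
  rw [IsBasePalindrome, ← hval, key]
  simp [hr]

theorem isBasePalindrome_of_lt {g d : ℕ} (hd : d < g) : IsBasePalindrome g d := by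
  rcases Nat.eq_zero_or_pos d with rfl | h
  · simp [IsBasePalindrome]
  · rw [IsBasePalindrome, Nat.digits_of_lt g d h.ne' hd, List.reverse_singleton]

theorem isBasePalindrome_two {g d : ℕ} (hg : 1 < g) (hd : d < g) :
    IsBasePalindrome g (d * (g + 1)) := by
  rcases Nat.eq_zero_or_pos d with rfl | h
  · simp [IsBasePalindrome]
  · simpa using (palString_zero g).isBasePalindrome_wrap hd h hg

theorem isBasePalindrome_three {g d e : ℕ} (hd : d < g) (hd0 : 0 < d) (he : e < g) :
    IsBasePalindrome g (d * (g ^ 2 + 1) + g * e) :=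
  (palString_one he).isBasePalindrome_wrap hd hd0 (by omega)

theorem isBasePalindrome_four {g d e : ℕ} (hd : d < g) (hd0 : 0 < d) (he : e < g) :
    IsBasePalindrome g (d * (g ^ 3 + 1) + g * (e * (g + 1))) := by
  have h := (palString_zero g).wrap he
  simp only [zero_add, pow_one, mul_zero, add_zero] at h
  exact h.isBasePalindrome_wrap hd hd0 (by omega)

theorem isShiftedSum_zero {g n : ℕ} (h : n < g ^ 2) : IsShiftedSum g 0 n := by
  have hg : 0 < g := Nat.pos_of_ne_zero (by rintro rfl; simp at h)
  refine ⟨n / g, n % g, 0, palString_one ?_, palString_one (Nat.mod_lt _ hg), palString_zero g, ?_⟩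
  · exact Nat.div_lt_of_lt_mul (by rwa [← sq])
  · rw [add_zero, Nat.div_add_mod]

theorem isShiftedSum_one {g n : ℕ} (h : n < g ^ 2 * (g + 1)) (hn : n % (g + 1) ≠ g) :
    IsShiftedSum g 1 n := by
  have hg : 0 < g := Nat.pos_of_ne_zero (by rintro rfl; simp at h)
  have h2 := (palString_zero g).wrap (d := n / (g + 1) / g)
    (Nat.div_lt_of_lt_mul (Nat.div_lt_of_lt_mul (by linarith)))
  have h3 := (palString_zero g).wrap (d := n / (g + 1) % g) (Nat.mod_lt _ hg)
  have h4 := Nat.mod_lt n g.succ_pos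
  rw [Nat.succ_eq_add_one] at h4
  refine ⟨_, _, n % (g + 1), h2, h3, palString_one (by omega), ?_⟩
  have e1 := Nat.div_add_mod n (g + 1)
  have e2 := Nat.div_add_mod (n / (g + 1)) g
  linear_combination -e1 - (g + 1) * e2

theorem isStaggeredSum_zero {g n : ℕ} (h : n < g * (g + 1)) (hn : n % (g + 1) ≠ g) :
    IsStaggeredSum g 0 n := by
  have h2 := (palString_zero g).wrap (d := n / (g + 1)) (Nat.div_lt_of_lt_mul (by linarith))
  have h4 := Nat.mod_lt n g.succ_pos
  rw [Nat.succ_eq_add_one] at h4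
  refine ⟨_, n % (g + 1), 0, h2, palString_one (by omega), palString_zero g, ?_⟩
  have e1 := Nat.div_add_mod n (g + 1)
  linear_combination -e1

theorem exists_three_digit_decomposition {g n : ℕ} (hg : 5 ≤ g) (h : n < g ^ 3) :
    ∃ x e y z, x < g ∧ e < g ∧ y < g ∧ z < g ∧ (g ^ 2 < n → 0 < x) ∧
      n = (x * (g ^ 2 + 1) + g * e) + y * (g + 1) + z := by
  have hg2 : 0 < g ^ 2 := by positivity
  have hgg : 5 * g ≤ g ^ 2 := by nlinarith
  have ha : n / g ^ 2 < g := Nat.div_lt_of_lt_mul (by rwa [← pow_succ])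
  have hr := Nat.mod_lt n hg2
  have hn := Nat.div_add_mod n (g ^ 2)
  generalize n / g ^ 2 = a at ha hn
  generalize n % g ^ 2 = r at hr hn
  rcases le_or_gt a r with har | har
  · have e1 := Nat.div_add_mod (r - a) g
    refine ⟨a, (r - a) / g, 0, (r - a) % g, ha, Nat.div_lt_of_lt_mul (by rw [← sq]; omega),
      by omega, Nat.mod_lt _ (by omega), ?_, ?_⟩
    · intro h
      by_contra h0
      have : a = 0 := by omega
      rw [this] at hn
      omega
    · zify [har] at e1 hn ⊢
      linear_combination -hn - e1
  · obtain ⟨b, rfl⟩ : ∃ b, a = b + 1 := ⟨a - 1, by omega⟩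
    obtain ⟨v, hv⟩ : ∃ v, v + g + b + 1 = g ^ 2 + r := ⟨g ^ 2 + r - g - b - 1, by omega⟩
    have e1 := Nat.div_add_mod v g
    refine ⟨b, v / g, 1, v % g, by omega, Nat.div_lt_of_lt_mul (by rw [← sq]; omega),
      by omega, Nat.mod_lt _ (by omega), ?_, ?_⟩
    · intro h
      by_contra h0
      have : b = 0 := by omega
      subst this
      omega
    · linear_combination -hn - e1 - hv

theorem isStaggeredSum_one {g n : ℕ} (hg : 5 ≤ g) (h : n < g ^ 3) : IsStaggeredSum g 1 n := by
  obtain ⟨x, e, y, z, hx, he, hy, hz, -, rfl⟩ := exists_three_digit_decomposition hg h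
  have h2 := (palString_zero g).wrap hy
  simp only [zero_add, pow_one, mul_zero, add_zero] at h2
  exact ⟨_, _, z, (palString_one he).wrap hx, h2, palString_one hz, rfl⟩

theorem IsStaggeredSum.wrap {g k m x y z : ℕ} (h : IsStaggeredSum g k m) (hx : x < g) (hy : y < g)
    (hz : z < g) : IsStaggeredSum g (k + 2)
      ((x * g + y) * (g * g ^ (k + 1)) + (x + y) + z * (g ^ (k + 1) + 1) + g * m) := by
  obtain ⟨X, Y, Z, hX, hY, hZ, rfl⟩ := h
  exact ⟨_, _, _, hX.wrap hx, hY.wrap hy, hZ.wrap hz, by ring⟩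

theorem IsStaggeredSum.isSumThreePalindromes {g k m x y z : ℕ} (h : IsStaggeredSum g k m)
    (hg : 1 < g) (hx : x < g) (hy : y < g) (hz : z < g) (hx0 : 0 < x) (hy0 : 0 < y)
    (hz0 : k = 0 ∨ 0 < z) : IsSumThreePalindromes g
      ((x * g + y) * (g * g ^ (k + 1)) + (x + y) + z * (g ^ (k + 1) + 1) + g * m) := by
  obtain ⟨X, Y, Z, hX, hY, hZ, rfl⟩ := h
  refine ⟨_, _, z * (g ^ (k + 1) + 1) + g * Z, hX.isBasePalindrome_wrap hx hx0 hg,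
    hY.isBasePalindrome_wrap hy hy0 hg, ?_, by ring⟩
  rcases hz0 with rfl | hz0
  · obtain ⟨l, hl, -, -, rfl⟩ := hZ
    rw [List.length_eq_zero_iff] at hl
    subst hl
    simpa using isBasePalindrome_two hg hz
  · exact hZ.isBasePalindrome_wrap hz hz0 hg

theorem IsShiftedSum.wrap {g k m t z : ℕ} (h : IsShiftedSum g k m) (ht : t < g ^ 2)
    (hz : z < g) : IsShiftedSum g (k + 2)
      (t * (g * g ^ (k + 1)) + t + z * (g ^ (k + 1) + 1) + g * m) := by
  obtain ⟨X, Y, Z, hX, hY, hZ, rfl⟩ := h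
  have e := Nat.div_add_mod t g
  refine ⟨_, _, _, hX.wrap (d := t / g) (Nat.div_lt_of_lt_mul (by rwa [← sq])),
    hY.wrap (d := t % g) (Nat.mod_lt _ (by omega)), hZ.wrap hz, ?_⟩
  linear_combination (g ^ (k + 2) + 1) * e.symm

theorem IsShiftedSum.isSumThreePalindromes {g k m t z : ℕ} (h : IsShiftedSum g k m)
    (hg : 1 < g) (ht : t < g ^ 2) (hz : z < g) (ht0 : t % g ≠ 0) (hz0 : 0 < z) :
    IsSumThreePalindromes g (g ^ (k + 4) + 1 +
      (t * (g * g ^ (k + 1)) + t + z * (g ^ (k + 1) + 1) + g * m)) := by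
  obtain ⟨X, Y, Z, hX, hY, hZ, rfl⟩ := h
  have e := Nat.div_add_mod t g
  have hX' := hX.wrap (d := t / g) (Nat.div_lt_of_lt_mul (by rwa [← sq]))
  refine ⟨_, _, _, hX'.isBasePalindrome_wrap hg one_pos hg,
    hY.isBasePalindrome_wrap (d := t % g) (Nat.mod_lt _ (by omega)) (by omega) hg,
    hZ.isBasePalindrome_wrap hz hz0 hg, ?_⟩
  linear_combination (g ^ (k + 2) + 1) * e.symm

theorem exists_peel {g q n t w c : ℕ} (hg : 5 ≤ g) (hgq : g ∣ q) (h1 : (t + 2) * (g * q) ≤ n + 1)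
    (h2 : n < (t + c) * (g * q)) (hw : w + g ≤ g * q + q) :
    ∃ z m, z < g ∧ n = t * (g * q) + w + z * (q + 1) + g * m ∧ m < c * q ∧
      (w + g ≤ q → q ≤ m) ∧ (n % g ≠ w % g → 0 < z) := by
  obtain ⟨p, rfl⟩ := hgq
  have hB : 5 * (g * p) ≤ g * (g * p) := Nat.mul_le_mul_right _ hg
  rw [add_mul] at h1 h2
  obtain ⟨u, hu⟩ : ∃ u, n = t * (g * (g * p)) + w + u :=
    ⟨n - (t * (g * (g * p)) + w), by omega⟩
  have hz := Nat.mod_lt u (show g > 0 by omega)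
  have hum := Nat.div_add_mod u g
  generalize u % g = z at hz hum
  generalize u / g = v at hum
  have hzq : z * (g * p) + g * p ≤ g * (g * p) := by
    rw [← Nat.succ_mul]
    exact Nat.mul_le_mul_right _ hz
  have hv : z * p ≤ v := by
    refine le_of_mul_le_mul_left (a := g) ?_ (by omega)
    rw [mul_left_comm]
    omega
  obtain ⟨m, rfl⟩ := Nat.exists_eq_add_of_le hv
  have hexp : g * (z * p + m) = z * (g * p) + g * m := by ring
  rw [hexp] at hum
  refine ⟨z, m, hz, ?_, ?_, ?_, ?_⟩
  · rw [mul_add, mul_one]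
    omega
  · refine lt_of_mul_lt_mul_left (a := g) ?_ (Nat.zero_le g)
    rw [mul_left_comm]
    omega
  · intro hwq
    refine le_of_mul_le_mul_left (a := g) ?_ (by omega)
    omega
  · intro hne
    rw [Nat.pos_iff_ne_zero]
    rintro rfl
    apply hne
    rw [hu, ← hum, show t * (g * (g * p)) + w + (0 * (g * p) + g * m + 0) =
      w + g * (t * (g * p) + m) by ring, Nat.add_mul_mod_self_left]

theorem exists_peel_pair {g n t w : ℕ} (hg : 5 ≤ g) (h1 : (t + 3) * (g * g) ≤ n + 1)
    (h2 : n < (t + 6) * (g * g)) (hw : w < 2 * g) :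
    ∃ i z m, i ≤ 1 ∧ z < g ∧ n = (t + i) * (g * g) + (w + i) + z * (g + 1) + g * m ∧
      m < g * (g + 1) ∧ m % (g + 1) ≠ g := by
  have hgg : 5 * g ≤ g * g := Nat.mul_le_mul_right _ hg
  obtain ⟨z, m, hz, hn, hm, -⟩ := exists_peel (t := t) (w := w) (c := 6) hg dvd_rfl
    (le_trans (Nat.mul_le_mul_right _ (by omega)) h1) h2 (by omega)
  obtain ⟨z', m', hz', hn', hm', -⟩ := exists_peel (t := t + 1) (w := w + 1) (c := 5) hg dvd_rfl
    h1 (by convert h2 using 2) (by omega)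
  by_cases hmr : m % (g + 1) = g
  · refine ⟨1, z', m', le_rfl, hz', hn', by rw [mul_add]; omega, fun hmr' => ?_⟩
    have e := Nat.div_add_mod m (g + 1)
    have e' := Nat.div_add_mod m' (g + 1)
    rw [hmr] at e
    rw [hmr'] at e'
    generalize m / (g + 1) = v at e
    generalize m' / (g + 1) = v' at e'
    have hd : ((g : ℤ) + 1) ∣ 2 := by
      refine ⟨z - z' + g * (v - v') - g + 1, ?_⟩
      zify at hn hn' e e'
      linear_combination hn - hn' + (g : ℤ) * e' - g * e
    have := Int.le_of_dvd two_pos hd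
    omega
  · exact ⟨0, z, m, by omega, hz, hn, by rw [mul_add]; omega, hmr⟩

theorem exists_admissible_offset {g : ℕ} (τ u z : ℕ) (hg : 5 ≤ g) :
    ∃ i ≤ 4, i ≠ τ ∧ z + i ≠ 0 ∧ z + i ≠ g ∧
      (z + i < g → u + 2 * i ≠ g ∧ u + 2 * i ≠ 2 * g + 1) ∧
      (g < z + i → u + 2 * (i + 1) ≠ g ∧ u + 2 * (i + 1) ≠ 2 * g + 1) ∧
      (i = 0 → z + 2 ≤ g) := by
  by_contra! hcon
  have c0 := hcon 0
  have c1 := hcon 1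
  have c2 := hcon 2
  have c3 := hcon 3
  have c4 := hcon 4
  clear hcon
  omega

theorem exists_shifted_peel {g n : ℕ} (hg : 5 ≤ g) (h1 : 5 * g ^ 3 ≤ n + 1)
    (h2 : n + 1 < (g ^ 2 + 1) * g ^ 3) : ∃ t z m, t < g ^ 2 ∧ t % g ≠ 0 ∧ 0 < z ∧ z < g ∧
      m < g ^ 2 * (g + 1) ∧ m % (g + 1) ≠ g ∧
      n = t * (g * g ^ 2) + t + z * (g ^ 2 + 1) + g * m := by
  have hg3 : 0 < g ^ 3 := by positivity
  obtain ⟨s, hs⟩ : ∃ s, (n + 1) / g ^ 3 = s + 1 :=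
    ⟨(n + 1) / g ^ 3 - 1, by have := (Nat.le_div_iff_mul_le hg3).2 h1; omega⟩
  have hs4 : 5 ≤ s + 1 := hs ▸ (Nat.le_div_iff_mul_le hg3).2 h1
  have hs2 : s + 1 < g ^ 2 + 1 := hs ▸ (Nat.div_lt_iff_lt_mul hg3).2 h2
  have hf := Nat.mod_lt (n + 1) hg3
  have hn := Nat.div_add_mod (n + 1) (g ^ 3)
  rw [hs] at hn
  generalize (n + 1) % g ^ 3 = f at hf hn
  have hg23 : 5 * g ^ 2 ≤ g ^ 3 := by
    rw [pow_succ' g 2]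
    exact Nat.mul_le_mul_right _ hg
  have hgg : 5 * g ≤ g ^ 2 := by nlinarith
  obtain ⟨v, hv⟩ : ∃ v, v + s + 1 = g ^ 3 + f := ⟨g ^ 3 + f - s - 1, by omega⟩
  have hz0 := Nat.mod_lt v (show g > 0 by omega)
  have hve := Nat.div_add_mod v g
  generalize v % g = z at hz0 hve
  generalize v / g = e at hve
  have he1 : g ^ 2 ≤ e + g := by
    by_contra! h
    have : g * (e + g + 1) ≤ g * g ^ 2 := Nat.mul_le_mul_left _ h
    nlinarith
  have he2 : e < 2 * g ^ 2 := by
    refine lt_of_mul_lt_mul_left (a := g) ?_ (Nat.zero_le g)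
    rw [show g * (2 * g ^ 2) = 2 * g ^ 3 by ring]
    omega
  have hu := Nat.mod_lt (e + z) g.succ_pos
  have hue := Nat.div_add_mod (e + z) (g + 1)
  rw [Nat.succ_eq_add_one] at hu
  generalize (e + z) % (g + 1) = u at hu hue
  generalize (e + z) / (g + 1) = h at hue
  have hres : ∀ (i m : ℕ) (k : ℤ), i ≤ 5 → m % (g + 1) = g →
      (e : ℤ) + z + 2 * i - m = (g + 1) * k → u + 2 * i = g ∨ u + 2 * i = 2 * g + 1 := by
    intro i m k hi hm hk
    have em := Nat.div_add_mod m (g + 1)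
    rw [hm] at em
    zify at em hue
    have hd : (u : ℤ) + 2 * i - g = (g + 1) * (k + (m / (g + 1) : ℕ) - h) := by
      push_cast
      linear_combination hk + hue - em
    generalize k + ((m / (g + 1) : ℕ) : ℤ) - h = r at hd
    have hr1 : r < 2 := by
      by_contra! h
      nlinarith
    have hr2 : -1 < r := by
      by_contra! h
      nlinarith
    interval_cases r <;> omega
  obtain ⟨i, hi, hiτ, hi0, hig, hlt, hge, hi0'⟩ := exists_admissible_offset (s % g) u z hg
  have hmod : (s - i) % g ≠ 0 := by
    intro h0
    obtain ⟨r, hr⟩ := Nat.dvd_of_mod_eq_zero h0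
    apply hiτ
    rw [show s = g * r + i by omega, Nat.mul_add_mod, Nat.mod_eq_of_lt (by omega)]
  obtain ⟨t, rfl⟩ : ∃ t, s = t + i := ⟨s - i, by omega⟩
  rw [Nat.add_sub_cancel] at hmod
  have hi4 : i * g ^ 2 ≤ 4 * g ^ 2 := Nat.mul_le_mul_right _ hi
  have hcap : 6 * g ^ 2 ≤ g ^ 2 * (g + 1) := by
    rw [mul_comm]
    exact Nat.mul_le_mul_left _ (by omega)
  rcases lt_or_gt_of_ne hig with hzi | hzi
  · obtain ⟨m, hm⟩ : ∃ m, m + (z + i) * g = e + i * g ^ 2 := by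
      refine ⟨e + i * g ^ 2 - (z + i) * g, Nat.sub_add_cancel ?_⟩
      rcases Nat.eq_zero_or_pos i with rfl | hi1
      · have := Nat.mul_le_mul_right g (hi0' rfl)
        nlinarith
      · have := Nat.mul_le_mul_right g hzi
        nlinarith
    refine ⟨t, z + i, m, by omega, hmod, by omega, hzi, by omega, ?_, ?_⟩
    · intro hmr
      have := hres i m (z + i * (2 - g)) (by omega) hmr (by
        zify at hm
        linear_combination -hm)
      have := hlt hzi
      omega
    · zify at *
      linear_combination -hn - hv - hve - (g : ℤ) * hm
  · obtain ⟨y, hy⟩ : ∃ y, z + i = g + y := ⟨z + i - g, by omega⟩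
    obtain ⟨m, hm⟩ : ∃ m, m + y * g = e + i * g ^ 2 + 1 := by
      refine ⟨e + i * g ^ 2 + 1 - y * g, Nat.sub_add_cancel ?_⟩
      have : y * g ≤ i * g ^ 2 := Nat.mul_le_mul (by omega) (by omega)
      omega
    have : 1 * g ≤ y * g := Nat.mul_le_mul_right _ (by omega)
    refine ⟨t, y, m, by omega, hmod, by omega, by omega, by omega, ?_, ?_⟩
    · intro hmr
      have := hres (i + 1) m (z + i * (2 - g) + 1 - g) (by omega) hmr (by
        zify at hm hy
        push_cast
        linear_combination -hm - (g : ℤ) * hy)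
      have := hge hzi
      omega
    · zify at *
      linear_combination -hn - hv - hve - (g : ℤ) * hm + hy

theorem exists_quotient {b n lo hi : ℕ} (hlo : 2 ≤ lo) (h1 : lo * b ≤ n + 1)
    (h2 : n + 1 < hi * b) : ∃ T, lo ≤ T + 2 ∧ T + 2 < hi ∧ (T + 2) * b ≤ n + 1 ∧
      n + 1 < (T + 3) * b := by
  have hb : 0 < b := Nat.pos_of_ne_zero (by rintro rfl; simp at h2)
  have h3 : lo ≤ (n + 1) / b := (Nat.le_div_iff_mul_le hb).2 h1
  have h4 : (n + 1) / b < hi := (Nat.div_lt_iff_lt_mul hb).2 h2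
  obtain ⟨T, hT⟩ : ∃ T, (n + 1) / b = T + 2 := ⟨(n + 1) / b - 2, by omega⟩
  refine ⟨T, by omega, by omega, hT ▸ Nat.div_mul_le_self _ _, ?_⟩
  rw [← Nat.div_lt_iff_lt_mul hb]
  omega

theorem isStaggeredSum_two {g n : ℕ} (hg : 5 ≤ g) (h1 : g ^ 3 ≤ n) (h2 : n < 5 * g ^ 3) :
    IsStaggeredSum g 2 n := by
  have hgg : 5 * g ≤ g * g := Nat.mul_le_mul_right _ hg
  obtain ⟨T, hT1, hT2, hn1, hn2⟩ := exists_quotient (b := g * g) (lo := g) (hi := 5 * g + 1)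
    (n := n) (by omega) (by nlinarith) (by nlinarith)
  obtain ⟨x, y, hy, hxy1, hxy2⟩ : ∃ x y, y + 1 < g ∧ x * g + y + 1 ≤ T ∧ T ≤ x * g + y + 2 := by
    have e := Nat.div_add_mod' T g
    have hlt := Nat.mod_lt T (show g > 0 by omega)
    rcases Nat.eq_zero_or_pos (T % g) with h0 | h0
    · rcases Nat.eq_zero_or_pos (T / g) with hq | hq
      · rw [hq] at e
        omega
      · obtain ⟨x, hx⟩ := Nat.exists_eq_add_of_lt hq
        rw [hx, zero_add, add_mul] at e
        exact ⟨x, g - 2, by omega, by omega, by omega⟩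
    · exact ⟨T / g, T % g - 1, by omega, by omega, by omega⟩
  have hx : x < g := by
    by_contra! hx
    have := Nat.mul_le_mul_right g hx
    omega
  obtain ⟨i, z, m, hi, hz, hn, hm, hmr⟩ := exists_peel_pair (t := x * g + y) (w := x + y) (n := n)
    hg (le_trans (Nat.mul_le_mul_right _ (by omega)) hn1)
    (((Nat.lt_succ_self n).trans hn2).trans_le (Nat.mul_le_mul_right _ (by omega))) (by omega)
  have := (isStaggeredSum_zero hm hmr).wrap hx (show y + i < g by omega) hz
  convert this using 1
  rw [hn]
  ring

theorem isStaggeredSum_of_le_of_lt {g : ℕ} (hg : 5 ≤ g) (k : ℕ) : ∀ n, g ^ (k + 2) ≤ n →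
    n < 5 * g ^ (k + 2) → IsStaggeredSum g (k + 1) n := by
  induction k using Nat.twoStepInduction with
  | zero =>
    intro n _ h2
    refine isStaggeredSum_one hg (h2.trans_le ?_)
    rw [pow_succ' g 2]
    exact Nat.mul_le_mul_right _ hg
  | one => exact fun n => isStaggeredSum_two hg
  | more k ih _ =>
    intro n h1 h2
    have hgg : 5 * g ≤ g ^ 2 := by nlinarith
    have hq : g ^ 2 ≤ g ^ (k + 1 + 1) := Nat.pow_le_pow_right (by omega) (by omega)
    have hpow : g ^ (k + 2 + 2) = g * (g * g ^ (k + 1 + 1)) := by ring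
    have hb : 0 < g * g ^ (k + 1 + 1) := by positivity
    rw [hpow] at h1 h2
    obtain ⟨T, hT1, hT2, hn1, hn2⟩ := exists_quotient (b := g * g ^ (k + 1 + 1)) (lo := g)
      (hi := 5 * g + 1) (n := n) (by omega) (by omega) (by rw [add_mul, mul_assoc]; omega)
    have e := Nat.div_add_mod' T g
    have hy := Nat.mod_lt T (show g > 0 by omega)
    have hx : T / g < g := Nat.div_lt_of_lt_mul (by rw [← sq]; omega)
    obtain ⟨z, m, hz, hn, hm, hqm, -⟩ := exists_peel (t := T) (w := T / g + T % g) (c := 5) hg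
      (dvd_pow_self g (by omega)) hn1
      (((Nat.lt_succ_self n).trans hn2).trans_le (Nat.mul_le_mul_right _ (by omega)))
      (by rw [show g * g ^ (k + 1 + 1) = g ^ (k + 1 + 1) * g by ring]; nlinarith)
    have := (ih m (hqm (by omega)) hm).wrap hx hy hz
    rwa [e, ← hn] at this

theorem isShiftedSum_add_two {g k n : ℕ} (hg : 5 ≤ g)
    (hk : ∀ m, (6 * g ≤ g ^ (k + 1) → g ^ (k + 1) ≤ m) → m < 5 * g ^ (k + 1) → IsShiftedSum g k m)
    (h1 : g ^ (k + 3) ≤ n) (h2 : n < 5 * g ^ (k + 3)) : IsShiftedSum g (k + 2) n := by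
  have hgg : 5 * g ≤ g ^ 2 := by nlinarith
  have hq : g ≤ g ^ (k + 1) := Nat.le_self_pow (by omega) g
  have hgq : g * g ≤ g * g ^ (k + 1) := Nat.mul_le_mul_left _ hq
  have hpow : g ^ (k + 3) = g * (g * g ^ (k + 1)) := by ring
  rw [hpow] at h1 h2
  obtain ⟨T, hT1, hT2, hn1, hn2⟩ := exists_quotient (b := g * g ^ (k + 1)) (lo := g)
    (hi := 5 * g + 1) (n := n) (by omega) (by omega) (by rw [add_mul, mul_assoc]; nlinarith)
  obtain ⟨z, m, hz, hn, hm, hqm, -⟩ := exists_peel (t := T) (w := T) (c := 5) hg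
    (dvd_pow_self g (by omega)) hn1
    (((Nat.lt_succ_self n).trans hn2).trans_le (Nat.mul_le_mul_right _ (by omega)))
    (by nlinarith)
  have := (hk m (fun h => hqm (by omega)) hm).wrap (show T < g ^ 2 by omega) hz
  rwa [← hn] at this

theorem isShiftedSum_three {g n : ℕ} (hg : 5 ≤ g) (h1 : g ^ 4 ≤ n) (h2 : n < 5 * g ^ 4) :
    IsShiftedSum g 3 n := by
  have hgg : 5 * g ≤ g ^ 2 := by nlinarith
  have e : g ^ 4 = g * g ^ 3 := by ring
  have h3 : 5 * g ^ 3 ≤ g * g ^ 3 := Nat.mul_le_mul_right _ hg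
  have h4 : 5 * g * g ^ 3 ≤ g ^ 2 * g ^ 3 := Nat.mul_le_mul_right _ hgg
  obtain ⟨t, z, m, ht, -, -, hz, hm, hmr, rfl⟩ := exists_shifted_peel (n := n) hg (by omega)
    (by rw [add_mul, one_mul]; have : 0 < g ^ 3 := by positivity
        rw [mul_assoc] at h4; omega)
  exact (isShiftedSum_one hm hmr).wrap ht hz

theorem isShiftedSum_of_le_of_lt {g : ℕ} (hg : 5 ≤ g) (k : ℕ) : ∀ n, g ^ (k + 3) ≤ n →
    n < 5 * g ^ (k + 3) → IsShiftedSum g (k + 2) n := by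
  have hgg : 5 * g ≤ g ^ 2 := by nlinarith
  induction k using Nat.twoStepInduction with
  | zero =>
    exact fun n => isShiftedSum_add_two hg fun m _ hm => isShiftedSum_zero (by simp at hm; omega)
  | one => exact fun n => isShiftedSum_three hg
  | more k ih _ =>
    refine fun n => isShiftedSum_add_two hg fun m h1 h2 => ih m (h1 ?_) h2
    have hq : g ^ 3 ≤ g ^ (k + 3) := Nat.pow_le_pow_right (by omega) (by omega)
    calc 6 * g ≤ g ^ 2 * g := Nat.mul_le_mul_right _ (by omega)
      _ = g ^ 3 := by ring
      _ ≤ g ^ (k + 3) := hq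

theorem isSumThreePalindromes_of_staggered {g k x y c n : ℕ} (hg : 5 ≤ g) (hk : 1 ≤ k)
    (hP : ∀ m, g ^ (k + 1) ≤ m → m < c * g ^ (k + 1) → IsStaggeredSum g k m)
    (hx0 : 0 < x) (hx : x < g) (hy0 : 0 < y) (hy : y < g)
    (h1 : (x * g + y + 2) * (g * g ^ (k + 1)) ≤ n + 1)
    (h2 : n < (x * g + y + c) * (g * g ^ (k + 1))) (hne : n % g ≠ (x + y) % g) :
    IsSumThreePalindromes g n := by
  have hgg : 5 * g ≤ g ^ 2 := by nlinarith
  have hq : g ^ 2 ≤ g ^ (k + 1) := Nat.pow_le_pow_right (by omega) (by omega)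
  obtain ⟨z, m, hz, hn, hm, hqm, hz0⟩ := exists_peel (w := x + y) hg
    (dvd_pow_self g (by omega)) h1 h2 (by omega)
  rw [hn]
  exact (hP m (hqm (by omega)) hm).isSumThreePalindromes (by omega) hx hy hz hx0 hy0
    (Or.inr (hz0 hne))

theorem isSumThreePalindromes_of_shifted {g k t n : ℕ} (hg : 5 ≤ g)
    (hP : ∀ m, (t + g ≤ g ^ (k + 1) → g ^ (k + 1) ≤ m) → m < 5 * g ^ (k + 1) → IsShiftedSum g k m)
    (ht : t < g ^ 2) (ht0 : t % g ≠ 0) (h1 : (t + 2) * (g * g ^ (k + 1)) ≤ n + 1)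
    (h2 : n < (t + 5) * (g * g ^ (k + 1))) (hne : n % g ≠ t % g) :
    IsSumThreePalindromes g (g ^ (k + 4) + 1 + n) := by
  have hq : g ≤ g ^ (k + 1) := Nat.le_self_pow (by omega) g
  have hgq : g * g ≤ g * g ^ (k + 1) := Nat.mul_le_mul_left _ hq
  obtain ⟨z, m, hz, hn, hm, hqm, hz0⟩ := exists_peel (w := t) hg
    (dvd_pow_self g (by omega)) h1 h2 (by rw [sq] at ht; omega)
  rw [hn]
  exact (hP m hqm hm).isSumThreePalindromes (by omega) ht hz ht0 (hz0 hne)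

theorem isSumThreePalindromes_of_lt_sq {g n : ℕ} (hg : 5 ≤ g) (hn : n < g ^ 2) :
    IsSumThreePalindromes g n := by
  obtain ⟨G, rfl⟩ := Nat.exists_eq_add_of_le' hg
  have hb := Nat.mod_lt n (show G + 5 > 0 by omega)
  have ha : n / (G + 5) < G + 5 := Nat.div_lt_of_lt_mul (by rwa [← sq])
  rw [← Nat.div_add_mod' n (G + 5)]
  generalize n / (G + 5) = a at ha
  generalize n % (G + 5) = b at hb
  rcases le_or_gt a b with hab | hab
  · obtain ⟨c, rfl⟩ := Nat.exists_eq_add_of_le hab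
    exact ⟨a * (G + 5 + 1), c, 0, isBasePalindrome_two (by omega) ha,
      isBasePalindrome_of_lt (by omega), isBasePalindrome_of_lt (by omega), by ring⟩
  · obtain ⟨c, rfl⟩ := Nat.exists_eq_add_of_lt hab
    rcases Nat.eq_zero_or_pos c with rfl | hc
    · exact ⟨b * (G + 5 + 1), G + 4, 1, isBasePalindrome_two (by omega) (by omega),
        isBasePalindrome_of_lt (by omega), isBasePalindrome_of_lt (by omega), by ring⟩
    · obtain ⟨d, hd⟩ : ∃ d, d + c = G + 5 := ⟨G + 5 - c, by omega⟩
      refine ⟨(b + c) * (G + 5 + 1), d, 0, isBasePalindrome_two (by omega) (by omega),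
        isBasePalindrome_of_lt (by omega), isBasePalindrome_of_lt (by omega), ?_⟩
      rw [← hd]
      ring

theorem isSumThreePalindromes_of_lt_cube {g n : ℕ} (hg : 5 ≤ g) (h1 : g ^ 2 ≤ n)
    (h2 : n < g ^ 3) : IsSumThreePalindromes g n := by
  rcases h1.eq_or_lt with rfl | h1
  · obtain ⟨G, rfl⟩ := Nat.exists_eq_add_of_le' hg
    exact ⟨(G + 4) * (G + 5 + 1), 1, 0, isBasePalindrome_two (by omega) (by omega),
      isBasePalindrome_of_lt (by omega), isBasePalindrome_of_lt (by omega), by ring⟩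
  · obtain ⟨x, e, y, z, hx, he, hy, hz, hx0, hn⟩ := exists_three_digit_decomposition hg h2
    exact ⟨_, _, _, isBasePalindrome_three hx (hx0 h1) he, isBasePalindrome_two (by omega) hy,
      isBasePalindrome_of_lt hz, hn⟩

theorem isSumThreePalindromes_of_cube_add {g r : ℕ} (hg : 5 ≤ g) (hr : r < 4 * g ^ 2) :
    IsSumThreePalindromes g (g ^ 3 + r) := by
  obtain ⟨G, rfl⟩ := Nat.exists_eq_add_of_le' hg
  rcases r with _ | r
  · exact ⟨(G + 4) * ((G + 5) ^ 2 + 1) + (G + 5) * (G + 4), 1, 0,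
      isBasePalindrome_three (by omega) (by omega) (by omega),
      isBasePalindrome_of_lt (by omega), isBasePalindrome_of_lt (by omega), by ring⟩
  have hz := Nat.mod_lt r (show G + 5 + 1 > 0 by omega)
  have hq : r / (G + 5 + 1) < 4 * (G + 5) := Nat.div_lt_of_lt_mul (by nlinarith)
  rw [← Nat.div_add_mod' r (G + 5 + 1)]
  generalize r % (G + 5 + 1) = z at hz
  generalize r / (G + 5 + 1) = q at hq
  have hy := Nat.mod_lt q (show G + 5 > 0 by omega)
  have hx : q / (G + 5) < 4 := Nat.div_lt_of_lt_mul (by omega)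
  rw [← Nat.div_add_mod' q (G + 5)]
  generalize q % (G + 5) = y at hy
  generalize q / (G + 5) = x at hx
  have four {e : ℕ} (he : e < G + 5) :=
    isBasePalindrome_four (show 1 < G + 5 by omega) one_pos he
  have three {d e : ℕ} (hd : d < G + 5) (hd0 : 0 < d) (he : e < G + 5) :=
    isBasePalindrome_three hd hd0 he
  have two {d : ℕ} (hd : d < G + 5) := isBasePalindrome_two (show 1 < G + 5 by omega) hd
  have one {d : ℕ} (hd : d < G + 5) := isBasePalindrome_of_lt hd
  rcases Nat.lt_or_ge z (G + 5) with hz' | hz'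
  · exact ⟨_, _, _, four (show x < G + 5 by omega), two hy, one hz', by ring⟩
  obtain rfl : z = G + 5 := by omega
  rcases y with _ | y
  · exact ⟨_, _, _, four (show x < G + 5 by omega), one (show G + 4 < G + 5 by omega),
      one (show 1 < G + 5 by omega), by ring⟩
  by_cases hy1 : y = G + 3
  · subst hy1
    exact ⟨_, _, _, four (show x < G + 5 by omega),
      three (show 1 < G + 5 by omega) one_pos (show 0 < G + 5 by omega),
      one (show G + 3 < G + 5 by omega), by ring⟩
  rcases x with _ | x
  · rcases Nat.lt_or_ge (y + 1) (G + 2) with hy2 | hy2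
    · exact ⟨_, _, _, three (show G + 4 < G + 5 by omega) (by omega) hy,
        two (show G + 4 < G + 5 by omega), one (show y + 4 < G + 5 by omega), by ring⟩
    · obtain ⟨c, rfl⟩ := Nat.exists_eq_add_of_le' (show G + 1 ≤ y by omega)
      exact ⟨_, _, _, three (show G + 4 < G + 5 by omega) (by omega)
        (show c + (G + 1) + 2 < G + 5 by omega),
        two (show G + 4 < G + 5 by omega), one (show c < G + 5 by omega), by ring⟩
  · by_cases hy2 : y = G + 2
    · subst hy2
      exact ⟨_, _, _, four (show x < G + 5 by omega),
        three (show 1 < G + 5 by omega) one_pos (show 3 < G + 5 by omega),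
        two (show G + 2 < G + 5 by omega), by ring⟩
    · exact ⟨_, _, _, four (show x < G + 5 by omega),
        three (show 1 < G + 5 by omega) one_pos (show y + 3 < G + 5 by omega),
        one (show y < G + 5 by omega), by ring⟩

theorem isSumThreePalindromes_of_lt_fourth {g n : ℕ} (hg : 5 ≤ g) (h1 : (g + 4) * (g * g) ≤ n)
    (h2 : n < g ^ 4) : IsSumThreePalindromes g n := by
  have hgg : 5 * g ≤ g * g := Nat.mul_le_mul_right _ hg
  obtain ⟨T, hT1, hT2, hn1, hn2⟩ := exists_quotient (b := g * g) (lo := g + 4) (hi := g * g + 1)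
    (n := n) (by omega) (by omega) (by nlinarith)
  obtain ⟨x, y, hx0, hx, hy0, hy, hxy1, hxy2⟩ : ∃ x y, 0 < x ∧ x < g ∧ 0 < y ∧ y + 1 < g ∧
      x * g + y + 1 ≤ T ∧ T ≤ x * g + y + 3 := by
    have e := Nat.div_add_mod' T g
    have hlt := Nat.mod_lt T (show g > 0 by omega)
    have hT : T / g < g := Nat.div_lt_of_lt_mul (by omega)
    have hT0 : 1 ≤ T / g := (Nat.le_div_iff_mul_le (by omega)).2 (by omega)
    rcases Nat.lt_or_ge (T % g) 2 with h0 | h0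
    · obtain ⟨x, hx⟩ := Nat.exists_eq_add_of_le' hT0
      rw [hx, add_mul] at e
      refine ⟨x, g - 2, Nat.pos_of_ne_zero ?_, by omega, by omega, by omega, by omega, by omega⟩
      rintro rfl
      omega
    · exact ⟨T / g, T % g - 1, by omega, by omega, by omega, by omega, by omega, by omega⟩
  obtain ⟨i, z, m, hi, hz, hn, hm, hmr⟩ := exists_peel_pair (t := x * g + y) (w := x + y) (n := n)
    hg (le_trans (Nat.mul_le_mul_right _ (by omega)) hn1)
    (((Nat.lt_succ_self n).trans hn2).trans_le (Nat.mul_le_mul_right _ (by omega))) (by omega)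
  have := (isStaggeredSum_zero hm hmr).isSumThreePalindromes (by omega) hx
    (show y + i < g by omega) hz hx0 (by omega) (Or.inl rfl)
  convert this using 1
  rw [hn]
  ring

theorem add_mod_ne_mod {g a c : ℕ} (hc0 : 0 < c) (hc : c < g) : (a + c) % g ≠ a % g := by
  intro h
  have := (Nat.modEq_iff_dvd' (Nat.le_add_right a c)).1 h.symm
  rw [Nat.add_sub_cancel_left] at this
  exact absurd (Nat.le_of_dvd hc0 this) (by omega)

theorem exists_staggered_digits {g T r : ℕ} (hg : 5 ≤ g) (h1 : 2 * g ≤ T + 2) (h2 : T < g * g) :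
    ∃ x y, 0 < x ∧ x < g ∧ 0 < y ∧ y < g ∧ x * g + y ≤ T ∧ T ≤ x * g + y + 2 ∧
      r % g ≠ (x + y) % g := by
  have e := Nat.div_add_mod' T g
  have hlt := Nat.mod_lt T (show g > 0 by omega)
  have hT : T / g < g := Nat.div_lt_of_lt_mul h2
  have hT0 : 1 ≤ T / g := (Nat.le_div_iff_mul_le (by omega)).2 (by omega)
  generalize T / g = x at *
  generalize T % g = y at *
  rcases Nat.lt_or_ge y 2 with hy | hy
  · obtain ⟨x, rfl⟩ := Nat.exists_eq_add_of_le' hT0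
    rw [add_mul] at e
    have hx0 : 0 < x := by
      refine Nat.pos_of_ne_zero ?_
      rintro rfl
      omega
    by_cases h : r % g = (x + (g - 1)) % g
    · have hne {a c : ℕ} (hc0 : 0 < c) (hc : c < g) (hac : a + c = x + (g - 1)) :
          r % g ≠ a % g := by
        rw [h, ← hac]
        exact add_mod_ne_mod hc0 hc
      rcases Nat.eq_zero_or_pos y with rfl | hy0
      · exact ⟨x, g - 2, hx0, by omega, by omega, by omega, by omega, by omega,
          hne one_pos (by omega) (by omega)⟩
      · exact ⟨x + 1, 1, by omega, hT, by omega, by omega, by rw [add_mul]; omega,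
          by rw [add_mul]; omega, hne (c := g - 3) (by omega) (by omega) (by omega)⟩
    · exact ⟨x, g - 1, hx0, by omega, by omega, by omega, by omega, by omega, h⟩
  · by_cases h : r % g = (x + y) % g
    · refine ⟨x, y - 1, by omega, hT, by omega, by omega, by omega, by omega, ?_⟩
      rw [h, show x + y = x + (y - 1) + 1 by omega]
      exact add_mod_ne_mod one_pos (by omega)
    · exact ⟨x, y, by omega, hT, by omega, by omega, by omega, by omega, h⟩

theorem exists_shifted_digit {g T r : ℕ} (hg : 5 ≤ g) (hT : 2 ≤ T) :
    ∃ t, t ≤ T ∧ T ≤ t + 2 ∧ t % g ≠ 0 ∧ r % g ≠ t % g := by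
  obtain ⟨t, rfl⟩ := Nat.exists_eq_add_of_le' hT
  by_contra! h
  have h0 := h t
  have h1 := h (t + 1)
  have h2 := h (t + 2)
  have e1 := add_mod_ne_mod (a := t) one_pos (show 1 < g by omega)
  have e2 := add_mod_ne_mod (a := t) two_pos (show 2 < g by omega)
  have e3 := add_mod_ne_mod (a := t + 1) one_pos (show 1 < g by omega)
  rw [add_assoc] at e3
  norm_num at h0 h1 h2 e3
  omega

theorem isSumThreePalindromes_of_two_mul_pow_le {g k n : ℕ} (hg : 5 ≤ g)
    (h1 : 2 * g ^ (k + 4) ≤ n) (h2 : n < g ^ (k + 5)) : IsSumThreePalindromes g n := by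
  have e1 : g ^ (k + 4) = g * (g * g ^ (k + 1 + 1)) := by ring
  have e2 : g ^ (k + 5) = g * g * (g * g ^ (k + 1 + 1)) := by ring
  have hb : 0 < g * g ^ (k + 1 + 1) := by positivity
  rw [e1, ← mul_assoc] at h1
  rw [e2] at h2
  obtain ⟨T, hT1, hT2, hn1, hn2⟩ := exists_quotient (b := g * g ^ (k + 1 + 1)) (lo := 2 * g)
    (hi := g * g + 1) (n := n) (by omega) (by omega) (by rw [add_mul, one_mul]; omega)
  obtain ⟨x, y, hx0, hx, hy0, hy, hxy1, hxy2, hne⟩ :=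
    exists_staggered_digits (r := n) hg hT1 (by omega)
  exact isSumThreePalindromes_of_staggered hg (by omega) (isStaggeredSum_of_le_of_lt hg k)
    hx0 hx hy0 hy (le_trans (Nat.mul_le_mul_right _ (by omega)) hn1)
    (((Nat.lt_succ_self n).trans hn2).trans_le (Nat.mul_le_mul_right _ (by omega))) hne

theorem isSumThreePalindromes_of_pow_add_of_staggered {g k d c r : ℕ} (hg : 5 ≤ g) (hk : 1 ≤ k)
    (hP : ∀ m, g ^ (k + 1) ≤ m → m < c * g ^ (k + 1) → IsStaggeredSum g k m)
    (hd0 : 0 < d) (hd : d < g) (h1 : 2 * (g * g ^ (k + 1)) ≤ r + 1 + d * (g * g ^ (k + 1)))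
    (h2 : r + d * (g * g ^ (k + 1)) < c * (g * g ^ (k + 1))) (hne : (r + d + 1) % g ≠ 0) :
    IsSumThreePalindromes g (g ^ (k + 4) + r) := by
  obtain ⟨x, rfl⟩ := Nat.exists_eq_add_of_le' (show 1 ≤ g by omega)
  obtain ⟨y, hy⟩ := Nat.exists_eq_add_of_le hd.le
  have e : (x + 1) ^ (k + 4) = (x * (x + 1) + y + d) * ((x + 1) * (x + 1) ^ (k + 1)) := by
    have : x * (x + 1) + y + d = (x + 1) * (x + 1) := by rw [add_assoc, add_comm y, ← hy]; ring
    rw [this]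
    ring
  refine isSumThreePalindromes_of_staggered (x := x) (y := y) (c := c) hg hk hP (by omega)
    (by omega) (by omega) (by omega) ?_ ?_ fun h => hne ?_
  · rw [e, add_mul, add_mul _ d]
    omega
  · rw [e, add_mul _ d, add_mul _ c]
    omega
  · have e3 : (x + 1) ^ (k + 4) + r ≡ r [MOD x + 1] := by
      simp [Nat.ModEq, pow_succ]
    have := (e3.symm.trans h).add_right (d + 1)
    rw [← add_assoc, show x + y + (d + 1) = (x + 1) + (x + 1) by omega] at this
    exact Eq.trans this (by simp)

theorem exists_staggered_offset {g : ℕ} (hg : 5 ≤ g) (d r : ℕ) :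
    (r + d + 1) % g ≠ 0 ∨ (r + (d + 1) + 1) % g ≠ 0 := by
  have := add_mod_ne_mod (a := r + d + 1) one_pos (show 1 < g by omega)
  rw [show r + d + 1 + 1 = r + (d + 1) + 1 by ring] at this
  omega

theorem isSumThreePalindromes_of_pow_add_of_shifted {g k r : ℕ} (hg : 5 ≤ g)
    (hP : ∀ t m, t < g ^ 2 → t % g ≠ 0 → (t + g ≤ g ^ (k + 1) → g ^ (k + 1) ≤ m) →
      m < 5 * g ^ (k + 1) → IsShiftedSum g k m)
    (h1 : 4 * (g * g ^ (k + 1)) ≤ r) (h2 : r < g ^ (k + 4)) :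
    IsSumThreePalindromes g (g ^ (k + 4) + r) := by
  have e2 : g ^ (k + 4) = g ^ 2 * (g * g ^ (k + 1)) := by ring
  have hb : 0 < g * g ^ (k + 1) := by positivity
  obtain ⟨n, rfl⟩ := Nat.exists_eq_add_of_le' (show 1 ≤ r by omega)
  obtain ⟨T, hT1, hT2, hn1, hn2⟩ := exists_quotient (b := g * g ^ (k + 1)) (lo := 4)
    (hi := g ^ 2 + 1) (n := n) (by omega) h1 (by rw [add_mul, one_mul]; omega)
  obtain ⟨t, ht1, ht2, ht0, hne⟩ := exists_shifted_digit (T := T) (r := n) hg (by omega)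
  rw [add_comm n, ← add_assoc]
  exact isSumThreePalindromes_of_shifted hg (fun m => hP t m (by omega) ht0) (by omega) ht0
    (le_trans (Nat.mul_le_mul_right _ (by omega)) hn1)
    (((Nat.lt_succ_self n).trans hn2).trans_le (Nat.mul_le_mul_right _ (by omega))) hne

theorem isSumThreePalindromes_of_fourth_add {g r : ℕ} (hg : 5 ≤ g) (hr : r < g ^ 4) :
    IsSumThreePalindromes g (g ^ 4 + r) := by
  have hgg : 5 * g ≤ g ^ 2 := by nlinarith
  rcases Nat.lt_or_ge r (4 * g ^ 2) with h1 | h1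
  · obtain ⟨d, hd0, hd, h2, h3⟩ : ∃ d, 0 < d ∧ d ≤ 2 ∧ 2 * g ^ 2 ≤ r + 1 + d * g ^ 2 ∧
        r + d * g ^ 2 < 5 * g ^ 2 := by
      rcases Nat.lt_or_ge r (g ^ 2) with h | h
      · exact ⟨2, by omega, by omega, by omega, by omega⟩
      · exact ⟨1, by omega, by omega, by omega, by omega⟩
    obtain ⟨y, rfl⟩ := Nat.exists_eq_add_of_le' (show d + 1 ≤ g by omega)
    generalize hG : y + (d + 1) = g at *
    have e : ((g - 1) * g + y + d + 1) = g * g := by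
      rw [add_assoc, add_assoc, hG, ← Nat.succ_mul]
      congr 1
      omega
    have e4 : g ^ 4 = ((g - 1) * g + y + d + 1) * (g * g) := by rw [e]; ring
    rw [sq] at h2 h3
    obtain ⟨i, z, m, hi, hz, hn, hm, hmr⟩ := exists_peel_pair (t := (g - 1) * g + y)
      (w := g - 1 + y) (n := g ^ 4 + r) hg (by rw [e4]; simp only [add_mul] at *; omega)
      (by rw [e4]; simp only [add_mul] at *; omega) (by omega)
    have := (isStaggeredSum_zero hm hmr).isSumThreePalindromes (by omega)
      (show g - 1 < g by omega) (show y + i < g by omega) hz (by omega) (by omega) (Or.inl rfl)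
    convert this using 1
    rw [hn]
    ring
  · refine isSumThreePalindromes_of_pow_add_of_shifted (k := 0) hg
      (fun t m _ _ _ hm => isShiftedSum_zero ?_) (by rw [zero_add, pow_one, ← sq]; exact h1) hr
    rw [zero_add, pow_one] at hm
    omega

theorem isSumThreePalindromes_of_forall_mem_range {g lo len : ℕ} {P : List (ℕ × ℕ)} {C : List ℕ}
    (hP : P.all fun p => Nat.digits g p.1 == (Nat.digits g p.1).reverse &&
      Nat.digits g p.2 == (Nat.digits g p.2).reverse)
    (hC : C.all fun c => Nat.digits g c == (Nat.digits g c).reverse)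
    (h : (List.range len).all fun i => P.any fun p => C.any fun c =>
      Nat.beq (lo + i) (p.1 + p.2 + c))
    {n : ℕ} (h1 : lo ≤ n) (h2 : n < lo + len) : IsSumThreePalindromes g n := by
  simp only [List.all_eq_true, Bool.and_eq_true, beq_iff_eq] at hP hC
  simp only [List.all_eq_true, List.any_eq_true, List.mem_range, Nat.beq_eq] at h
  obtain ⟨i, rfl⟩ := Nat.exists_eq_add_of_le h1
  obtain ⟨p, hp, c, hc, hpc⟩ := h i (by omega)
  exact ⟨p.1, p.2, c, (hP p hp).1, (hP p hp).2, hC c hc, hpc⟩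

theorem isSumThreePalindromes_five {n : ℕ} (h1 : 3500 ≤ n) (h2 : n < 3750) :
    IsSumThreePalindromes 5 n :=
  isSumThreePalindromes_of_forall_mem_range (lo := 3500) (len := 250)
    (P := [(1772, 1742), (3049, 564), (1878, 1742), (3099, 408), (3576, 41), (1978, 1612),
      (3124, 438), (2969, 534), (1772, 1717), (1878, 1612), (1903, 1742), (3024, 498),
      (3099, 564), (3124, 504), (2919, 594), (3049, 624), (2864, 624), (1797, 1772),
      (1822, 1822)])
    (C := [0, 1, 2, 3, 4, 6, 12, 18, 24, 26, 31, 36, 41, 46, 52, 57, 62, 67, 72, 78, 83, 88, 93, 98,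
      104, 109, 114, 119, 124])
    (by decide +kernel) (by decide +kernel) (by decide +kernel) h1 h2

theorem isSumThreePalindromes_six {n : ℕ} (h1 : 8640 ≤ n) (h2 : n < 8856) :
    IsSumThreePalindromes 6 n :=
  isSumThreePalindromes_of_forall_mem_range (lo := 8640) (len := 216)
    (P := [(7517, 1127), (7703, 952), (7777, 868), (4335, 4293), (8281, 385), (4371, 4293),
      (7775, 861), (7631, 994), (7331, 1295), (4335, 4257), (4443, 4407)])
    (C := [0, 1, 2, 3, 4, 5, 7, 14, 21, 28, 35, 37, 43, 49, 55, 61, 67, 74, 80, 86, 92, 98, 104,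
      111, 117, 123, 129, 135, 141, 148, 154, 160, 166, 172, 178, 185, 191, 197, 203, 209, 215])
    (by decide +kernel) (by decide +kernel) (by decide +kernel) h1 h2

theorem isSumThreePalindromes_of_fifth_add {g r : ℕ} (hg : 5 ≤ g) (hr : r < g ^ 5) :
    IsSumThreePalindromes g (g ^ 5 + r) := by
  have e5 : g ^ 5 = g ^ 2 * g ^ 3 := by ring
  have e3 : g * g ^ 2 = g ^ 3 := by ring
  have hg3 : 0 < g ^ 3 := by positivity
  rcases Nat.lt_or_ge (r + 2 * g ^ 3) (g * g ^ 3) with h1 | h1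
  · have hgg : 5 * g ^ 3 ≤ g * g ^ 3 := Nat.mul_le_mul_right _ hg
    have near {d : ℕ} (hd0 : 0 < d) (hd : d ≤ 3) (h2 : 2 * g ^ 3 ≤ r + 1 + d * g ^ 3)
        (h3 : r + d * g ^ 3 < g * g ^ 3) (hne : (r + d + 1) % g ≠ 0) :
        IsSumThreePalindromes g (g ^ 5 + r) :=
      isSumThreePalindromes_of_pow_add_of_staggered (k := 1) (c := g) hg le_rfl
        (fun m _ hm => isStaggeredSum_one hg (e3 ▸ hm)) hd0 (by omega) (by rwa [e3])
        (by rwa [e3]) hne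
    rcases Nat.lt_or_ge r (g ^ 3) with h | h
    · exact (exists_staggered_offset hg 2 r).elim
        (near (by omega) (by omega) (by omega) (by omega))
        (near (by omega) (by omega) (by omega) (by omega))
    · exact (exists_staggered_offset hg 1 r).elim
        (near (by omega) (by omega) (by omega) (by omega))
        (near (by omega) (by omega) (by omega) (by omega))
  rcases Nat.lt_or_ge r (5 * g ^ 3) with h2 | h2
  · have hlt : g < 7 := by
      by_contra! h
      have := Nat.mul_le_mul_right (g ^ 3) h
      omega
    interval_cases g
    · exact isSumThreePalindromes_five (by omega) (by omega)
    · exact isSumThreePalindromes_six (by omega) (by omega)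
  · obtain ⟨n, rfl⟩ := Nat.exists_eq_add_of_le' (show 1 ≤ r by omega)
    obtain ⟨t, z, m, ht, ht0, hz0, hz, hm, hmr, rfl⟩ := exists_shifted_peel (n := n) hg h2
      (by rw [add_mul, one_mul]; omega)
    convert (isShiftedSum_one hm hmr).isSumThreePalindromes (by omega) ht hz ht0 hz0 using 1
    ring

theorem isSumThreePalindromes_of_sixth_pow_add {g k r : ℕ} (hg : 5 ≤ g) (hr : r < g ^ (k + 6)) :
    IsSumThreePalindromes g (g ^ (k + 6) + r) := by
  have hb : 0 < g * g ^ (k + 2 + 1) := by positivity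
  rcases Nat.lt_or_ge r (4 * (g * g ^ (k + 2 + 1))) with h | h
  · have near {d : ℕ} := isSumThreePalindromes_of_pow_add_of_staggered (k := k + 2) (d := d)
      (r := r) hg (by omega) (isStaggeredSum_of_le_of_lt hg (k + 1))
    rcases Nat.lt_or_ge r (g * g ^ (k + 2 + 1)) with h1 | h1
    · exact (exists_staggered_offset hg 2 r).elim
        (near (by omega) (by omega) (by omega) (by omega))
        (near (by omega) (by omega) (by omega) (by omega))
    by_cases h2 : (r + 1 + 1) % g = 0
    · rcases Nat.lt_or_ge r (3 * (g * g ^ (k + 2 + 1))) with h3 | h3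
      · exact near (by omega) (by omega) (by omega) (by omega)
          ((exists_staggered_offset hg 1 r).resolve_left (not_not.2 h2))
      obtain ⟨n, rfl⟩ := Nat.exists_eq_add_of_le' (show 1 ≤ r by omega)
      rw [add_comm n, ← add_assoc]
      have h1g : 1 % g = 1 := Nat.mod_eq_of_lt (by omega)
      have hq : g ^ 2 ≤ g ^ (k + 2 + 1) := Nat.pow_le_pow_right (by omega) (by omega)
      have hgg : 5 * g ≤ g ^ 2 := by nlinarith
      refine isSumThreePalindromes_of_shifted (k := k + 2) (t := 1) hg
        (fun m hm => isShiftedSum_of_le_of_lt hg k m (hm (by omega))) (by omega) (by omega)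
        (by omega) (by omega) fun hn => ?_
      have h4 : n + 3 ≡ 1 + 3 [MOD g] := Nat.ModEq.add_right 3 hn
      have h5 : (n + 3) % g = 0 := h2
      rw [Nat.ModEq, h5, Nat.mod_eq_of_lt (by omega)] at h4
      omega
    · exact near (by omega) (by omega) (by omega) (by omega) h2
  · refine isSumThreePalindromes_of_pow_add_of_shifted (k := k + 2) hg
      (fun t m ht _ hm => isShiftedSum_of_le_of_lt hg k m (hm ?_)) h hr
    have hq : g ^ 3 ≤ g ^ (k + 2 + 1) := Nat.pow_le_pow_right (by omega) (by omega)
    nlinarith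

theorem isSumThreePalindromes_of_le_of_lt {g k n : ℕ} (hg : 5 ≤ g) (h1 : g ^ (k + 4) ≤ n)
    (h2 : n < g ^ (k + 5)) : IsSumThreePalindromes g n := by
  rcases Nat.lt_or_ge n (2 * g ^ (k + 4)) with h | h
  · obtain ⟨r, rfl⟩ := Nat.exists_eq_add_of_le h1
    have hr : r < g ^ (k + 4) := by omega
    match k, hr with
    | 0, hr => exact isSumThreePalindromes_of_fourth_add hg hr
    | 1, hr => exact isSumThreePalindromes_of_fifth_add hg hr
    | k + 2, hr => exact isSumThreePalindromes_of_sixth_pow_add hg hr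
  · exact isSumThreePalindromes_of_two_mul_pow_le hg h h2

theorem sum_three_palindromes (g : ℕ) (hg : 5 ≤ g) (n : ℕ) (hn : 0 < n) :
    ∃ a b c : ℕ, IsBasePalindrome g a ∧ IsBasePalindrome g b ∧ IsBasePalindrome g c ∧
      n = a + b + c := by
  rcases Nat.lt_or_ge n (g ^ 2) with h2 | h2
  · exact isSumThreePalindromes_of_lt_sq hg h2
  rcases Nat.lt_or_ge n (g ^ 3) with h3 | h3
  · exact isSumThreePalindromes_of_lt_cube hg h2 h3
  rcases Nat.lt_or_ge n (g ^ 4) with h4 | h4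
  · rcases Nat.lt_or_ge n ((g + 4) * (g * g)) with h | h
    · obtain ⟨r, rfl⟩ := Nat.exists_eq_add_of_le h3
      exact isSumThreePalindromes_of_cube_add hg (by nlinarith)
    · exact isSumThreePalindromes_of_lt_fourth hg h h4
  · have hk : 4 ≤ Nat.log g n := Nat.le_log_of_pow_le (by omega) h4
    obtain ⟨k, hk⟩ := Nat.exists_eq_add_of_le' hk
    exact isSumThreePalindromes_of_le_of_lt (k := k) hg (hk ▸ Nat.pow_log_le_self g hn.ne')
      (by simpa [hk] using Nat.lt_pow_succ_log_self (show 1 < g by omega) n)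
end

section
/- For every integer base g ≥ 2, there exists a constant c₁ > 0 (depending on g) such that for all x ≥ 2, the number of integers n ≤ x expressible as a sum of two base g palindromes is at least x^{1 - c₁/√(log x)}. -/
/-- A nonempty digit list with nonzero last digit that equals its reverse yields a palindrome. -/
theorem isBasePalindrome_ofDigits_cons_append {g : ℕ} (hg : 2 ≤ g) {l : List ℕ}
    (hl : l.reverse = l) (hd : ∀ i ∈ l, i < g) :
    IsBasePalindrome g (Nat.ofDigits g (1 :: (l ++ [1]))) := by
  have h : Nat.digits g (Nat.ofDigits g (1 :: (l ++ [1]))) = 1 :: (l ++ [1]) := by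
    apply Nat.digits_ofDigits g (by omega)
    · intro i hi
      simp only [List.mem_cons, List.mem_append, List.not_mem_nil, or_false] at hi
      rcases hi with rfl | hi | rfl
      · omega
      · exact hd i hi
      · omega
    · intro _
      simp
  unfold IsBasePalindrome
  rw [h]
  simp [hl]

/-- The list of `r + 2` digits obtained by placing a zero on each side of `a`. -/
def paddedBlock {g r : ℕ} (a : Fin r → Fin g) : List ℕ :=
  0 :: (List.ofFn (fun i => (a i : ℕ)) ++ [0])

section paddedBlock

variable {g r : ℕ}

theorem length_paddedBlock (a : Fin r → Fin g) : (paddedBlock a).length = r + 2 := by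
  simp [paddedBlock]

theorem lt_of_mem_paddedBlock (hg : 2 ≤ g) (a : Fin r → Fin g) :
    ∀ i ∈ paddedBlock a, i < g := by
  intro i hi
  simp only [paddedBlock, List.mem_cons, List.mem_append, List.mem_ofFn, List.not_mem_nil,
    or_false] at hi
  rcases hi with rfl | ⟨j, rfl⟩ | rfl
  · omega
  · exact (a j).isLt
  · omega

theorem paddedBlock_injective : Function.Injective (paddedBlock (g := g) (r := r)) := by
  intro a b h
  simp only [paddedBlock, List.cons.injEq, true_and, List.append_cancel_right_eq] at h
  have h' := List.ofFn_injective h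
  funext i
  exact Fin.ext (congrFun h' i)

theorem ofDigits_paddedBlock_injective (hg : 2 ≤ g) :
    Function.Injective (fun a : Fin r → Fin g => Nat.ofDigits g (paddedBlock a)) := by
  intro a b h
  refine paddedBlock_injective (Nat.ofDigits_inj_of_len_eq (by omega) ?_
    (lt_of_mem_paddedBlock hg a) (lt_of_mem_paddedBlock hg b) h)
  simp [length_paddedBlock]

theorem ofDigits_reverse_paddedBlock_injective (hg : 2 ≤ g) :
    Function.Injective (fun a : Fin r → Fin g => Nat.ofDigits g (paddedBlock a).reverse) := by
  intro a b h
  refine paddedBlock_injective (List.reverse_injective (Nat.ofDigits_inj_of_len_eq (by omega) ?_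
    ?_ ?_ h))
  · simp [length_paddedBlock]
  · simpa using lt_of_mem_paddedBlock hg a
  · simpa using lt_of_mem_paddedBlock hg b

theorem ofDigits_append_zero_lt (hg : 2 ≤ g) {l : List ℕ} (hl : ∀ i ∈ l, i < g) :
    Nat.ofDigits g (l ++ [0]) < g ^ l.length := by
  simpa [Nat.ofDigits_append] using Nat.ofDigits_lt_base_pow_length (by omega) hl

theorem ofDigits_paddedBlock_lt (hg : 2 ≤ g) (a : Fin r → Fin g) :
    Nat.ofDigits g (paddedBlock a) < g ^ (r + 1) := by
  have h := ofDigits_append_zero_lt hg (l := 0 :: List.ofFn (fun i => (a i : ℕ))) (by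
    intro i hi
    exact lt_of_mem_paddedBlock hg a i (by simp [paddedBlock] at hi ⊢; tauto))
  simpa [paddedBlock] using h

theorem ofDigits_reverse_paddedBlock_lt (hg : 2 ≤ g) (a : Fin r → Fin g) :
    Nat.ofDigits g (paddedBlock a).reverse < g ^ (r + 1) := by
  have h := ofDigits_append_zero_lt hg (l := 0 :: (List.ofFn (fun i => (a i : ℕ))).reverse) (by
    intro i hi
    exact lt_of_mem_paddedBlock hg a i (by simp [paddedBlock] at hi ⊢; tauto))
  simpa [paddedBlock] using h

end paddedBlock

/-- Surrounding a pair of palindromic digit lists by blocks gives a sum from which the blocks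
and the original sum can be read off. -/
theorem wrapped_sum_cancel {D B g E a a₁ a' a₁' c c₁ c' c₁' s s₁ : ℕ} (hg : 2 ≤ g)
    (hB : B = g * D) (ha' : a' < D) (hha₁' : a₁' < D) (hc : c < D) (hhc₁ : c₁ < D)
    (hc' : c' < D) (hhc₁' : c₁' < D) (hs : s < D * E) (hhs₁ : s₁ < D * E)
    (haa : a = a₁ → a' = a₁') (hcc : c' = c₁' → c = c₁)
    (h : a' + c' + B * s + c * (B * E) + a * (B * (B * E)) =
      a₁' + c₁' + B * s₁ + c₁ * (B * E) + a₁ * (B * (B * E))) :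
    a = a₁ ∧ c' = c₁' ∧ s = s₁ := by
  have h2D : 2 * D ≤ B := by rw [hB]; exact Nat.mul_le_mul_right _ hg
  have hE : 0 < E := Nat.pos_of_ne_zero (by rintro rfl; simp at hs)
  have key : ∀ {u v w t : ℕ}, u < D → v < D → w < D → t < D * E →
      u + v + B * t + w * (B * E) < B * (B * E) := by
    intro u v w t hu hv hw ht
    calc u + v + B * t + w * (B * E) < B + B * t + w * (B * E) := by omega
      _ = B * (t + 1) + w * (B * E) := by ring
      _ ≤ B * (D * E) + w * (B * E) := by gcongr; exact ht
      _ = (D + w) * (B * E) := by ring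
      _ ≤ B * (B * E) := by gcongr; omega
  have hlow := key ha' hc' hc hs
  have hlow₁ := key hha₁' hhc₁' hhc₁ hhs₁
  have hpos : 0 < B * (B * E) := by omega
  have ea : a = a₁ := by
    have h1 := congrArg (· / (B * (B * E))) h
    simpa [Nat.add_mul_div_right _ _ hpos, Nat.div_eq_of_lt hlow, Nat.div_eq_of_lt hlow₁] using h1
  have ea' := haa ea
  have ec' : c' = c₁' := by
    have h1 : (a' + c' + B * (s + c * E + a * (B * E))) % B =
        (a₁' + c₁' + B * (s₁ + c₁ * E + a₁ * (B * E))) % B := by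
      congr 1
      linarith
    rw [Nat.add_mul_mod_self_left, Nat.add_mul_mod_self_left, Nat.mod_eq_of_lt (by omega),
      Nat.mod_eq_of_lt (by omega)] at h1
    omega
  have ec := hcc ec'
  subst ea ea' ec' ec
  refine ⟨rfl, rfl, ?_⟩
  have h1 : B * s = B * s₁ := by omega
  exact Nat.eq_of_mul_eq_mul_left (by omega) h1

/-- Many sums of two palindromic digit lists, of lengths `(r + 2) * (2 * d + 1)` and
`(r + 2) * (2 * d)`, possibly with leading zeros. -/
theorem exists_finset_sum_palindromic_digits {g : ℕ} (hg : 2 ≤ g) (r d : ℕ) :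
    ∃ S : Finset ℕ, S.card = g ^ (2 * r * d) ∧ ∀ s ∈ S,
      s < g ^ (r + 1) * (g ^ (r + 2)) ^ (2 * d) ∧
      ∃ p q : List ℕ, p.reverse = p ∧ q.reverse = q ∧ (∀ i ∈ p, i < g) ∧ (∀ i ∈ q, i < g) ∧
        p.length = (r + 2) * (2 * d + 1) ∧ q.length = (r + 2) * (2 * d) ∧
        s = Nat.ofDigits g p + Nat.ofDigits g q := by
  induction d with
  | zero =>
    refine ⟨{0}, by simp, ?_⟩
    intro s hs
    obtain rfl : s = 0 := by simpa using hs
    refine ⟨by positivity, List.replicate (r + 2) 0, [], by simp, by simp, ?_, by simp, by simp,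
      by simp, ?_⟩
    · intro i hi
      rw [List.eq_of_mem_replicate hi]
      omega
    · simp [Nat.ofDigits_replicate_zero]
  | succ d ih =>
    obtain ⟨S, hcard, hS⟩ := ih
    let B := g ^ (r + 2)
    let E := B ^ (2 * d)
    let V : (Fin r → Fin g) → ℕ := fun a => Nat.ofDigits g (paddedBlock a)
    let W : (Fin r → Fin g) → ℕ := fun a => Nat.ofDigits g (paddedBlock a).reverse
    let f : ((Fin r → Fin g) × (Fin r → Fin g)) × ℕ → ℕ := fun x =>
      W x.1.1 + W x.1.2 + B * x.2 + V x.1.2 * (B * E) + V x.1.1 * (B * (B * E))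
    have hBD : B = g * g ^ (r + 1) := by simp only [B]; ring
    have hf : Set.InjOn f (Finset.univ ×ˢ S :
        Finset (((Fin r → Fin g) × (Fin r → Fin g)) × ℕ)) := by
      rintro ⟨⟨a, c⟩, s⟩ hx ⟨⟨a₁, c₁⟩, s₁⟩ hx₁ h
      have hs : s ∈ S := by simpa using hx
      have hhs₁ : s₁ ∈ S := by simpa using hx₁
      obtain ⟨ea, ec, es⟩ := wrapped_sum_cancel hg hBD
        (ofDigits_reverse_paddedBlock_lt hg a) (ofDigits_reverse_paddedBlock_lt hg a₁)
        (ofDigits_paddedBlock_lt hg c) (ofDigits_paddedBlock_lt hg c₁)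
        (ofDigits_reverse_paddedBlock_lt hg c) (ofDigits_reverse_paddedBlock_lt hg c₁)
        (hS s hs).1 (hS s₁ hhs₁).1
        (fun e => congrArg W (ofDigits_paddedBlock_injective hg e))
        (fun e => congrArg V (ofDigits_reverse_paddedBlock_injective hg e)) h
      rw [ofDigits_paddedBlock_injective hg ea, ofDigits_reverse_paddedBlock_injective hg ec, es]
    refine ⟨(Finset.univ ×ˢ S).image f, ?_, ?_⟩
    · rw [Finset.card_image_of_injOn hf, Finset.card_product, hcard]
      simp only [Finset.card_univ, Fintype.card_prod, Fintype.card_fun, Fintype.card_fin]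
      ring
    · intro n hn
      obtain ⟨⟨⟨a, c⟩, s⟩, hx, rfl⟩ := Finset.mem_image.1 hn
      have hs : s ∈ S := by simpa using hx
      obtain ⟨hlt, p, q, hp, hq, hpd, hqd, hpl, hql, hsum⟩ := hS s hs
      refine ⟨?_, (paddedBlock a).reverse ++ (p ++ paddedBlock a),
        (paddedBlock c).reverse ++ (q ++ paddedBlock c), ?_, ?_, ?_, ?_, ?_, ?_, ?_⟩
      · have hWa : W a < g ^ (r + 1) := ofDigits_reverse_paddedBlock_lt hg a
        have hWc : W c < g ^ (r + 1) := ofDigits_reverse_paddedBlock_lt hg c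
        have hVc : V c < g ^ (r + 1) := ofDigits_paddedBlock_lt hg c
        have hVa : V a + 1 ≤ g ^ (r + 1) := ofDigits_paddedBlock_lt hg a
        have hlt' : s + 1 ≤ g ^ (r + 1) * E := hlt
        have h2D : 2 * g ^ (r + 1) ≤ B := by rw [hBD]; exact Nat.mul_le_mul_right _ hg
        calc f ((a, c), s)
            = W a + W c + B * s + V c * (B * E) + V a * (B * (B * E)) := rfl
          _ < B + B * s + V c * (B * E) + V a * (B * (B * E)) := by omega
          _ = B * (s + 1) + V c * (B * E) + V a * (B * (B * E)) := by ring
          _ ≤ B * (g ^ (r + 1) * E) + V c * (B * E) + V a * (B * (B * E)) := by gcongr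
          _ = (g ^ (r + 1) + V c) * (B * E) + V a * (B * (B * E)) := by ring
          _ ≤ B * (B * E) + V a * (B * (B * E)) := by gcongr; omega
          _ = (V a + 1) * (B * (B * E)) := by ring
          _ ≤ g ^ (r + 1) * (B * (B * E)) := by gcongr
          _ = g ^ (r + 1) * B ^ (2 * (d + 1)) := by simp only [E]; ring
      · simp [hp]
      · simp [hq]
      · intro i hi
        simp only [List.mem_append, List.mem_reverse] at hi
        rcases hi with hi | hi | hi
        · exact lt_of_mem_paddedBlock hg a i hi
        · exact hpd i hi
        · exact lt_of_mem_paddedBlock hg a i hi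
      · intro i hi
        simp only [List.mem_append, List.mem_reverse] at hi
        rcases hi with hi | hi | hi
        · exact lt_of_mem_paddedBlock hg c i hi
        · exact hqd i hi
        · exact lt_of_mem_paddedBlock hg c i hi
      · simp only [List.length_append, List.length_reverse, length_paddedBlock, hpl]; ring
      · simp only [List.length_append, List.length_reverse, length_paddedBlock, hql]; ring
      · simp only [Nat.ofDigits_append, List.length_reverse, length_paddedBlock, hpl, hql]
        simp only [f, V, W, E, B, hsum, pow_mul, pow_succ]
        ring

/-- Many sums of two palindromes below a given power of the base. -/
theorem exists_finset_sum_palindromes {g : ℕ} (hg : 2 ≤ g) (r d : ℕ) :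
    ∃ T : Finset ℕ, T.card = g ^ (2 * r * d) ∧ ∀ n ∈ T,
      n ≤ g ^ ((r + 2) * (2 * d + 1) + 4) ∧
      ∃ p q : ℕ, IsBasePalindrome g p ∧ IsBasePalindrome g q ∧ n = p + q := by
  obtain ⟨S, hcard, hS⟩ := exists_finset_sum_palindromic_digits hg r d
  let L := (r + 2) * (2 * d + 1)
  let M := (r + 2) * (2 * d)
  let f : ℕ → ℕ := fun s => 2 + g * s + g ^ (M + 1) + g ^ (L + 1)
  refine ⟨S.image f, ?_, ?_⟩
  · rw [Finset.card_image_of_injective, hcard]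
    intro s t h
    simp only [f] at h
    exact Nat.eq_of_mul_eq_mul_left (by omega : 0 < g) (by omega)
  · intro n hn
    obtain ⟨s, hs, rfl⟩ := Finset.mem_image.1 hn
    obtain ⟨hlt, p, q, hp, hq, hpd, hqd, hpl, hql, hsum⟩ := hS s hs
    refine ⟨?_, _, _, isBasePalindrome_ofDigits_cons_append hg hp hpd,
      isBasePalindrome_ofDigits_cons_append hg hq hqd, ?_⟩
    · have h1 : g ^ (r + 1) * (g ^ (r + 2)) ^ (2 * d) ≤ g ^ L := by
        rw [← pow_mul, ← pow_add]
        exact Nat.pow_le_pow_right (by omega) (by simp only [L]; nlinarith)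
      have h2 : g ^ (M + 1) ≤ g ^ (L + 1) :=
        Nat.pow_le_pow_right (by omega) (by simp only [L, M]; nlinarith)
      have h3 : 2 ≤ g ^ (L + 1) := hg.trans (Nat.le_self_pow (by omega) g)
      have h4 : g * s ≤ g ^ (L + 1) := by
        rw [pow_succ']
        exact Nat.mul_le_mul_left _ (by omega)
      have h5 : 2 ^ 3 ≤ g ^ 3 := Nat.pow_le_pow_left hg 3
      calc f s = 2 + g * s + g ^ (M + 1) + g ^ (L + 1) := rfl
        _ ≤ g ^ (L + 1) * 2 ^ 3 := by omega
        _ ≤ g ^ (L + 1) * g ^ 3 := by gcongr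
        _ = g ^ (L + 4) := by ring
    · simp only [Nat.ofDigits_cons, Nat.ofDigits_append, Nat.ofDigits_nil, hpl, hql, f, L, M,
        hsum]
      ring

theorem many_sums_of_two_palindromes (g : ℕ) (hg : 2 ≤ g) :
    ∃ c₁ : ℝ, 0 < c₁ ∧ ∀ x : ℝ, 2 ≤ x →
      ((({n : ℕ | (n : ℝ) ≤ x ∧ ∃ p q : ℕ, IsBasePalindrome g p ∧ IsBasePalindrome g q ∧
        n = p + q}).ncard : ℝ)) ≥ x ^ (1 - c₁ / Real.sqrt (Real.log x)) := by
  have hg0 : (0 : ℝ) < g := by exact_mod_cast (by omega : 0 < g)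
  have hlg : 0 < Real.log g := Real.log_pos (by exact_mod_cast (by omega : 1 < g))
  refine ⟨22 * √(Real.log g), by positivity, ?_⟩
  intro x hx
  have hx0 : 0 < x := by linarith
  have hlx : 0 < Real.log x := Real.log_pos (by linarith)
  set A := {n : ℕ | (n : ℝ) ≤ x ∧ ∃ p q : ℕ, IsBasePalindrome g p ∧ IsBasePalindrome g q ∧
        n = p + q} with hA
  have hfin : A.Finite := (Set.finite_Iic ⌊x⌋₊).subset fun n hn => Nat.le_floor hn.1
  set u := √(Real.log x) with hu
  set v := √(Real.log g) with hv
  have hu0 : 0 < u := Real.sqrt_pos.2 hlx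
  have hv0 : 0 < v := Real.sqrt_pos.2 hlg
  have hu2 : u ^ 2 = Real.log x := Real.sq_sqrt hlx.le
  have hv2 : v ^ 2 = Real.log g := Real.sq_sqrt hlg.le
  have hrhs : x ^ (1 - 22 * v / u) = Real.exp (u ^ 2 - 22 * v * u) := by
    rw [Real.rpow_def_of_pos hx0, ← hu2]
    congr 1
    field_simp
  rw [hrhs]
  have hex : ∃ t : ℕ, u ^ 2 < (2 * t ^ 2 + 5 * t + 6) * v ^ 2 := by
    obtain ⟨t, ht⟩ := exists_nat_gt (u ^ 2 / v ^ 2)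
    refine ⟨t, ?_⟩
    rw [div_lt_iff₀ (by positivity)] at ht
    have : (t : ℝ) ≤ 2 * t ^ 2 + 5 * t + 6 := by nlinarith [Nat.cast_nonneg (α := ℝ) t]
    nlinarith [sq_nonneg v]
  classical
  rcases hT : Nat.find hex with _ | t
  · have h1 := Nat.find_spec hex
    rw [hT] at h1
    have hmem : (0 : ℕ) ∈ A :=
      ⟨by simpa using hx0.le, 0, 0, by simp [IsBasePalindrome], by simp [IsBasePalindrome], rfl⟩
    have hone : (1 : ℝ) ≤ A.ncard := by
      exact_mod_cast (Set.ncard_pos hfin).2 ⟨0, hmem⟩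
    refine le_trans (Real.exp_le_one_iff.2 ?_) hone
    have : u < 22 * v := by
      norm_num at h1
      nlinarith
    nlinarith
  · have h1 := Nat.find_spec hex
    rw [hT] at h1
    have h2 : (2 * (t : ℝ) ^ 2 + 5 * t + 6) * v ^ 2 ≤ u ^ 2 :=
      not_lt.1 (Nat.find_min hex (m := t) (by omega))
    obtain ⟨T, hcard, hT'⟩ := exists_finset_sum_palindromes hg t t
    have hsub : (T : Set ℕ) ⊆ A := by
      intro n hn
      obtain ⟨hle, hpq⟩ := hT' n hn
      refine ⟨?_, hpq⟩
      calc (n : ℝ) ≤ (g : ℝ) ^ ((t + 2) * (2 * t + 1) + 4) := by exact_mod_cast hle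
        _ = Real.exp (((t + 2) * (2 * t + 1) + 4 : ℕ) * Real.log g) := by
          rw [Real.exp_nat_mul, Real.exp_log hg0]
        _ ≤ Real.exp (Real.log x) := by
          apply Real.exp_le_exp.2
          rw [← hu2, ← hv2]
          push_cast
          linarith
        _ = x := Real.exp_log hx0
    have hle : T.card ≤ A.ncard := by
      rw [← Set.ncard_coe_finset]
      exact Set.ncard_le_ncard hsub hfin
    calc Real.exp (u ^ 2 - 22 * v * u) ≤ Real.exp ((2 * t * t : ℕ) * Real.log g) := by
          apply Real.exp_le_exp.2
          rw [← hv2]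
          push_cast at h1 ⊢
          have ht0 : (0 : ℝ) ≤ t := Nat.cast_nonneg t
          have htv : t * v ≤ u := by
            apply le_of_sq_le_sq _ hu0.le
            nlinarith [sq_nonneg v, mul_nonneg ht0 (sq_nonneg v),
              mul_nonneg (mul_nonneg ht0 ht0) (sq_nonneg v)]
          have hvu : v ≤ u := by
            apply le_of_sq_le_sq _ hu0.le
            nlinarith [sq_nonneg v, mul_nonneg ht0 (sq_nonneg v),
              mul_nonneg (mul_nonneg ht0 ht0) (sq_nonneg v)]
          nlinarith [mul_le_mul_of_nonneg_left htv hv0.le, mul_le_mul_of_nonneg_left hvu hv0.le]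
      _ = (T.card : ℝ) := by
          rw [Real.exp_nat_mul, Real.exp_log hg0, hcard]
          push_cast
          rfl
      _ ≤ A.ncard := by exact_mod_cast hle
end

section
/- Let g ≥ 5. Every positive integer with exactly six base g digits is a sum of three base g palindromes. -/
def IsSumOfThree (g n : ℕ) : Prop :=
  ∃ p q r : ℕ, IsBasePalindrome g p ∧ IsBasePalindrome g q ∧ IsBasePalindrome g r ∧
    n = p + q + r

theorem isBasePalindrome_ofDigits {g : ℕ} (hg : 1 < g) {L : List ℕ} (h : ∀ x ∈ L, x < g)
    (hlast : ∀ hL : L ≠ [], L.getLast hL ≠ 0) (hrev : L.reverse = L) :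
    IsBasePalindrome g (Nat.ofDigits g L) := by
  rw [IsBasePalindrome, Nat.digits_ofDigits g hg L h hlast, hrev]

theorem isBasePalindrome_one_digit {g a : ℕ} (ha : a < g) :
    IsBasePalindrome g a := by
  rcases Nat.eq_zero_or_pos a with rfl | h
  · simp [IsBasePalindrome]
  · simp [IsBasePalindrome, Nat.digits_of_lt g a h.ne' ha]

theorem isBasePalindrome_two_digits {g a : ℕ} (hg : 1 < g) (ha : 0 < a) (ha' : a < g) :
    IsBasePalindrome g (a * (g + 1)) := by
  have h := isBasePalindrome_ofDigits (L := [a, a]) hg (by simp; omega) (by simp; omega) rfl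
  convert h using 1
  simp [Nat.ofDigits_cons]
  ring

theorem isBasePalindrome_three_digits {g a b : ℕ} (hg : 1 < g) (ha : 0 < a) (ha' : a < g)
    (hb : b < g) : IsBasePalindrome g (a * (g ^ 2 + 1) + b * g) := by
  have h := isBasePalindrome_ofDigits (L := [a, b, a]) hg (by simp; omega) (by simp; omega) rfl
  convert h using 1
  simp [Nat.ofDigits_cons]
  ring

theorem isBasePalindrome_four_digits {g a b : ℕ} (hg : 1 < g) (ha : 0 < a) (ha' : a < g)
    (hb : b < g) : IsBasePalindrome g (a * (g ^ 3 + 1) + b * (g ^ 2 + g)) := by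
  have h := isBasePalindrome_ofDigits (L := [a, b, b, a]) hg (by simp; omega) (by simp; omega) rfl
  convert h using 1
  simp [Nat.ofDigits_cons]
  ring

theorem isBasePalindrome_five_digits {g a b c : ℕ} (hg : 1 < g) (ha : 0 < a) (ha' : a < g)
    (hb : b < g) (hc : c < g) :
    IsBasePalindrome g (a * (g ^ 4 + 1) + b * (g ^ 3 + g) + c * g ^ 2) := by
  have h := isBasePalindrome_ofDigits (L := [a, b, c, b, a]) hg (by simp; omega) (by simp; omega)
    rfl
  convert h using 1
  simp [Nat.ofDigits_cons]
  ring

theorem isBasePalindrome_six_digits {g a b c : ℕ} (hg : 1 < g) (ha : 0 < a) (ha' : a < g)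
    (hb : b < g) (hc : c < g) :
    IsBasePalindrome g (a * (g ^ 5 + 1) + b * (g ^ 4 + g) + c * (g ^ 3 + g ^ 2)) := by
  have h := isBasePalindrome_ofDigits (L := [a, b, c, c, b, a]) hg (by simp; omega)
    (by simp; omega) rfl
  convert h using 1
  simp [Nat.ofDigits_cons]
  ring

/-- Sums of two five-digit palindromes, parametrized by the sums `s`, `t`, `w` of their digits. -/
theorem exists_five_digits_add_five_digits {g s t w : ℕ} (hg : 1 < g) (hs : 2 ≤ s)
    (hs' : s ≤ 2 * g - 2) (ht : t ≤ 2 * g - 2) (hw : w ≤ 2 * g - 2) :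
    ∃ p q, IsBasePalindrome g p ∧ IsBasePalindrome g q ∧
      s * (g ^ 4 + 1) + t * (g ^ 3 + g) + w * g ^ 2 = p + q := by
  obtain ⟨x, x', rfl, hx⟩ : ∃ x x', s = x + x' ∧ 0 < x ∧ x < g ∧ 0 < x' ∧ x' < g :=
    ⟨s / 2, s - s / 2, by omega, by omega⟩
  obtain ⟨y, y', rfl, hy⟩ : ∃ y y', t = y + y' ∧ y < g ∧ y' < g :=
    ⟨t / 2, t - t / 2, by omega, by omega⟩
  obtain ⟨z, z', rfl, hz⟩ : ∃ z z', w = z + z' ∧ z < g ∧ z' < g :=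
    ⟨w / 2, w - w / 2, by omega, by omega⟩
  exact ⟨_, _, isBasePalindrome_five_digits hg hx.1 hx.2.1 hy.1 hz.1,
    isBasePalindrome_five_digits hg hx.2.2.1 hx.2.2.2 hy.2 hz.2, by ring⟩

/-- Column addition: `C i` are the column sums, `k i` the carries and `d i` the digits. -/
theorem column_addition {g d₀ d₁ d₂ d₃ d₄ d₅ C₀ C₁ C₂ C₃ C₄ C₅ k₁ k₂ k₃ k₄ k₅ : ℕ}
    (h₀ : C₀ = d₀ + g * k₁) (h₁ : C₁ + k₁ = d₁ + g * k₂) (h₂ : C₂ + k₂ = d₂ + g * k₃)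
    (h₃ : C₃ + k₃ = d₃ + g * k₄) (h₄ : C₄ + k₄ = d₄ + g * k₅) (h₅ : C₅ + k₅ = d₅) :
    d₀ + d₁ * g + d₂ * g ^ 2 + d₃ * g ^ 3 + d₄ * g ^ 4 + d₅ * g ^ 5 =
      C₀ + C₁ * g + C₂ * g ^ 2 + C₃ * g ^ 3 + C₄ * g ^ 4 + C₅ * g ^ 5 := by
  zify at *
  linear_combination -h₀ - g * h₁ - g ^ 2 * h₂ - g ^ 3 * h₃ - g ^ 4 * h₄ - g ^ 5 * h₅

theorem exists_mem_window {g d : ℕ} (hd : d < g) (X m : ℕ) :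
    ∃ t k, m ≤ t ∧ t < m + g ∧ X + t = d + g * k := by
  have h₁ := Nat.div_add_mod (X + m + g - 1 - d) g
  have h₂ := Nat.mod_lt (X + m + g - 1 - d) (show 0 < g by omega)
  exact ⟨m + g - 1 - (X + m + g - 1 - d) % g, (X + m + g - 1 - d) / g, by omega, by omega,
    by omega⟩

theorem carry_lt {g X d k m : ℕ} (h : X = d + g * k) (hX : X < g * m) : k < m :=
  Nat.lt_of_mul_lt_mul_left (a := g) (by omega)

section

variable {g d₀ d₁ d₂ d₃ d₄ d₅ : ℕ}

/-- Six, five and five digits, once the outer two columns are settled. -/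
theorem isSumOfThree_six_five_five {a b s k₁ k₅ : ℕ} (hg : 5 ≤ g) (h₁ : d₁ < g) (h₂ : d₂ < g)
    (h₃ : d₃ < g) (ha : 0 < a) (ha' : a < g) (hb : b < g) (hs : 2 ≤ s) (hs' : s ≤ 2 * g - 2)
    (c₀ : a + s = d₀ + g * k₁) (c₄ : b + s + 1 = d₄ + g * k₅) (c₅ : a + k₅ = d₅) :
    IsSumOfThree g
      (d₀ + d₁ * g + d₂ * g ^ 2 + d₃ * g ^ 3 + d₄ * g ^ 4 + d₅ * g ^ 5) := by
  have hk₁ : k₁ < 3 := carry_lt c₀ (by omega)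
  obtain ⟨t, k₂, ht, ht', c₁⟩ := exists_mem_window h₁ (b + k₁) d₃
  have hk₂ : k₂ < 4 := carry_lt c₁ (by omega)
  obtain ⟨c, w, k₃, hc, hw, c₂, c₃⟩ : ∃ c w k₃, c < g ∧ w ≤ 2 * g - 2 ∧
      c + w + k₂ = d₂ + g * k₃ ∧ c + t + k₃ = d₃ + g * 1 := by
    by_cases hlow : d₃ + g - 1 - t + k₂ > d₂ + g
    · exact ⟨d₃ + g - 2 - t, d₂ + g * 2 - (d₃ + g - 2 - t) - k₂, 2, by
        interval_cases k₂ <;> omega⟩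
    · by_cases hhigh : d₃ + g - 1 - t + k₂ = 0 ∧ d₂ = g - 1
      · exact ⟨1, g - 2, 0, by omega⟩
      · exact ⟨d₃ + g - 1 - t, d₂ + g - (d₃ + g - 1 - t) - k₂, 1, by omega⟩
  obtain ⟨p, q, hp, hq, hpq⟩ := exists_five_digits_add_five_digits (g := g) (by omega) hs hs'
    (show t ≤ 2 * g - 2 by interval_cases k₂ <;> omega) hw
  refine ⟨p, q, _, hp, hq, isBasePalindrome_six_digits (by omega) ha ha' hb hc, ?_⟩
  rw [← hpq, column_addition c₀ (C₁ := b + t) (by linarith) c₂ c₃ c₄ c₅]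
  ring

/-- Five, five and three digits, with last digit `u` of the three-digit summand. -/
theorem isSumOfThree_five_five_three {u k₁ : ℕ} (hg : 5 ≤ g) (h₁ : d₁ < g) (h₂ : d₂ < g)
    (h₃ : d₃ < g) (h₄ : d₄ < g) (hu : 0 < u) (hu' : u < g)
    (c₀ : d₄ + g - 1 + u = d₀ + g * k₁) :
    IsSumOfThree g (d₀ + d₁ * g + d₂ * g ^ 2 + d₃ * g ^ 3 + d₄ * g ^ 4 + 1 * g ^ 5) := by
  have hk₁ : k₁ < 3 := carry_lt c₀ (by omega)
  obtain ⟨t, v, w, k₂, k₃, ht, hv, hw, c₁, c₂, c₃⟩ : ∃ t v w k₂ k₃, t ≤ 2 * g - 2 ∧ v < g ∧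
      w ≤ 2 * g - 2 ∧ t + v + k₁ = d₁ + g * k₂ ∧ w + u + k₂ = d₂ + g * k₃ ∧
      t + k₃ = d₃ + g * 1 := by
    obtain ⟨v, k₂, -, hv, c₁⟩ := exists_mem_window h₁ (d₃ + g - 1 + k₁) 0
    have hk₂ : k₂ < 4 := carry_lt c₁ (by omega)
    by_cases hlow : u + k₂ ≤ d₂ + g
    · exact ⟨d₃ + g - 1, v, d₂ + g - u - k₂, k₂, 1, by omega⟩
    · by_cases hv' : v + 1 < g
      · exact ⟨d₃ + g - 2, v + 1, d₂ + g * 2 - u - k₂, k₂, 2, by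
          interval_cases k₂ <;> omega⟩
      · exact ⟨d₃ + g - 2, 0, d₂ + g * 2 - u - (k₂ - 1), k₂ - 1, 2, by
          interval_cases k₂ <;> omega⟩
  obtain ⟨p, q, hp, hq, hpq⟩ := exists_five_digits_add_five_digits (g := g) (s := d₄ + g - 1)
    (by omega) (by omega) (by omega) ht hw
  refine ⟨p, q, _, hp, hq, isBasePalindrome_three_digits (by omega) hu hu' hv, ?_⟩
  rw [← hpq, column_addition c₀ c₁ c₂ c₃ (C₄ := d₄ + g - 1) (k₅ := 1) (C₅ := 0) (by omega)
    (by omega)]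
  ring

theorem isSumOfThree_leading_one (hg : 5 ≤ g) (h₀ : d₀ < g) (h₁ : d₁ < g) (h₂ : d₂ < g)
    (h₃ : d₃ < g) (h₄ : d₄ < g) :
    IsSumOfThree g (d₀ + d₁ * g + d₂ * g ^ 2 + d₃ * g ^ 3 + d₄ * g ^ 4 + 1 * g ^ 5) := by
  obtain ⟨u, k₁, -, hu', c₀⟩ := exists_mem_window h₀ (d₄ + g - 1) 0
  have hk₁ : k₁ < 3 := carry_lt c₀ (by omega)
  rcases Nat.eq_zero_or_pos u with rfl | hu
  swap
  · exact isSumOfThree_five_five_three hg h₁ h₂ h₃ h₄ hu (by omega) c₀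
  have hd : d₄ = d₀ + 1 ∨ d₄ = 0 ∧ d₀ = g - 1 := by interval_cases k₁ <;> omega
  by_cases h₃₀ : d₃ = 0
  · subst h₃₀
    by_cases hbad : d₂ = 0 ∧ (d₄ = d₀ + 1 ∧ d₁ = g - 2 ∨ d₄ = 0 ∧ d₁ = g - 3)
    · obtain ⟨rfl, ⟨rfl, rfl⟩ | ⟨rfl, rfl⟩⟩ := hbad
      · obtain ⟨y, r, hy, hr, h⟩ : ∃ y r, y < g ∧ r < g ∧
            y * g + r + 2 + (d₀ + 2) * g = g * g + d₀ := by
          obtain ⟨m, rfl⟩ : ∃ m, g = d₀ + 2 + m := Nat.exists_eq_add_of_le (by omega)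
          match d₀ with
          | 0 => exact ⟨m - 1, m, by omega, by omega, by
              obtain ⟨l, rfl⟩ : ∃ l, m = l + 1 := ⟨m - 1, by omega⟩
              simp only [Nat.add_sub_cancel]
              ring⟩
          | 1 => exact ⟨m - 1, m + 2, by omega, by omega, by
              obtain ⟨l, rfl⟩ : ∃ l, m = l + 1 := ⟨m - 1, by omega⟩
              simp only [Nat.add_sub_cancel]
              ring⟩
          | e + 2 => exact ⟨m, e, by omega, by omega, by ring⟩
        refine ⟨_, _, r, isBasePalindrome_six_digits (a := 1) (b := d₀) (c := g - 1) (by omega)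
          (by omega) (by omega) h₀ (by omega), isBasePalindrome_three_digits (a := 1) (by omega)
          (by omega) (by omega) hy, isBasePalindrome_one_digit hr, ?_⟩
        obtain ⟨m, rfl⟩ : ∃ m, g = m + 2 := ⟨g - 2, by omega⟩
        simp only [Nat.add_sub_cancel, show m + 2 - 1 = m + 1 by omega]
        zify at h ⊢
        linear_combination -h
      · refine ⟨_, _, 1, isBasePalindrome_six_digits (a := 1) (b := 0) (c := 0) (by omega)
          (by omega) (by omega) (by omega) (by omega), isBasePalindrome_two_digits (a := g - 3)
          (by omega) (by omega) (by omega), isBasePalindrome_one_digit (by omega), ?_⟩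
        obtain ⟨m, rfl⟩ : ∃ m, g = m + 3 := ⟨g - 3, by omega⟩
        obtain rfl : d₀ = m + 2 := by omega
        simp only [Nat.add_sub_cancel]
        ring
    · obtain ⟨v, k₂, -, hv, c₁⟩ := exists_mem_window h₁ (2 * g - 2 + k₁) 0
      have hk₂ : k₂ < 4 := carry_lt c₁ (by omega)
      have hw : v + k₂ ≤ d₂ + g ∧ 1 ≤ k₂ ∧ k₂ ≤ 2 := by
        interval_cases k₁ <;> interval_cases k₂ <;> omega
      obtain ⟨p, q, hp, hq, hpq⟩ := exists_five_digits_add_five_digits (g := g) (s := d₄ + g - 2)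
        (t := 2 * g - 2) (w := d₂ + g - v - k₂) (by omega) (by omega) (by omega) le_rfl (by omega)
      refine ⟨p, q, _, hp, hq, isBasePalindrome_four_digits (a := 1) (b := v) (by omega) (by omega)
        (by omega) (by omega), ?_⟩
      rw [← hpq, column_addition (C₀ := d₄ + g - 2 + 1) (C₁ := 2 * g - 2 + v)
        (C₂ := d₂ + g - v - k₂ + v) (C₃ := 2 * g - 2 + 1) (C₄ := d₄ + g - 2) (C₅ := 0) (k₁ := k₁)
        (k₂ := k₂) (k₃ := 1) (k₄ := 2) (k₅ := 1) (by omega) (by omega) (by omega) (by omega)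
        (by omega) (by omega)]
      ring
  · by_cases h₄₁ : d₄ = g - 1
    · exact isSumOfThree_six_five_five (a := 1) (b := 1) (s := g - 3) (k₁ := 0) (k₅ := 0) hg h₁ h₂
        h₃ (by omega) (by omega) (by omega) (by omega) (by omega) (by omega) (by omega) (by omega)
    · obtain ⟨v, k₂, -, hv, c₁⟩ := exists_mem_window h₁ (d₃ - 1 + (k₁ + 1)) 0
      have hk₂ : k₂ < 2 := carry_lt c₁ (by interval_cases k₁ <;> omega)
      obtain ⟨p, q, hp, hq, hpq⟩ := exists_five_digits_add_five_digits (g := g) (s := d₄ + g)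
        (t := d₃ - 1) (w := d₂ + 1 - k₂) (by omega) (by omega) (by omega) (by omega) (by omega)
      refine ⟨p, q, _, hp, hq, isBasePalindrome_three_digits (a := g - 1) (b := v) (by omega)
        (by omega) (by omega) (by omega), ?_⟩
      rw [← hpq, column_addition (C₀ := d₄ + g + (g - 1)) (C₁ := d₃ - 1 + v)
        (C₂ := d₂ + 1 - k₂ + (g - 1)) (C₃ := d₃ - 1) (C₄ := d₄ + g) (C₅ := 0) (k₁ := k₁ + 1)
        (k₂ := k₂) (k₃ := 1) (k₄ := 0) (k₅ := 1) (by rw [mul_add]; omega) (by omega) (by omega)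
        (by omega) (by omega) (by omega)]
      ring

/-- Six, five and three digits. -/
theorem isSumOfThree_leading_two (hg : 5 ≤ g) (h₁ : d₁ < g) (h₂ : d₂ < g) (h₃ : d₃ < g)
    (h : d₄ = 0 ∧ d₀ = 1 ∨ d₄ = 0 ∧ d₀ = 2 ∨ d₄ = 1 ∧ d₀ = 2) :
    IsSumOfThree g (d₀ + d₁ * g + d₂ * g ^ 2 + d₃ * g ^ 3 + d₄ * g ^ 4 + 2 * g ^ 5) := by
  obtain ⟨u, c, k₃, hu, hu', hc, hcd, hlow, hhigh⟩ : ∃ u c k₃, 2 ≤ u ∧ u < g ∧ c < g ∧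
      c + k₃ = d₃ + 1 ∧ d₂ + g * k₃ < c + u + 1 + g ∧ c + u + 2 ≤ d₂ + g * k₃ := by
    by_cases hd : d₂ + 2 ≤ d₃
    · exact ⟨g - 1, d₃ - 1, 2, by omega⟩
    · exact ⟨max 2 (d₂ - d₃), d₃, 1, by omega⟩
  obtain ⟨v, k₂, -, hv, c₁⟩ := exists_mem_window h₁ (u + d₄ - d₀ + g) 0
  have hk₂ : k₂ < 3 := carry_lt c₁ (by omega)
  have hk₂' : k₂ ≠ 0 := by rintro rfl; omega
  refine ⟨_, _, _,
    isBasePalindrome_six_digits (a := 1) (b := u + d₄ - d₀) (c := c) (by omega) (by omega)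
      (by omega) (by omega) hc,
    isBasePalindrome_five_digits (a := d₀ + g - 1 - u) (b := g - 1) (c := d₂ + g * k₃ - c - u - k₂)
      (by omega) (by omega) (by omega) (by omega) (by omega),
    isBasePalindrome_three_digits (a := u) (b := v) (by omega) (by omega) hu' (by omega), ?_⟩
  rw [column_addition (C₀ := 1 + (d₀ + g - 1 - u) + u) (C₁ := u + d₄ - d₀ + (g - 1) + v)
    (C₂ := c + (d₂ + g * k₃ - c - u - k₂) + u) (C₃ := c + (g - 1))
    (C₄ := u + d₄ - d₀ + (d₀ + g - 1 - u)) (C₅ := 1) (k₁ := 1)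
    (k₂ := k₂) (k₃ := k₃) (k₄ := 1) (k₅ := 1) (by omega) (by omega) (by omega)
    (by omega) (by omega) (by omega)]
  ring

theorem isSumOfThree_of_digits (hg : 5 ≤ g) (h₀ : d₀ < g) (h₁ : d₁ < g) (h₂ : d₂ < g)
    (h₃ : d₃ < g) (h₄ : d₄ < g) (h₅ : 0 < d₅) (h₅' : d₅ < g) :
    IsSumOfThree g (d₀ + d₁ * g + d₂ * g ^ 2 + d₃ * g ^ 3 + d₄ * g ^ 4 + d₅ * g ^ 5) := by
  rcases Nat.lt_or_ge d₅ 2 with h₅₁ | h₅₂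
  · obtain rfl : d₅ = 1 := by omega
    exact isSumOfThree_leading_one hg h₀ h₁ h₂ h₃ h₄
  obtain ⟨s, k₁, hs, hs', c₀⟩ := exists_mem_window h₀ (d₅ - 1) d₄
  by_cases hs₂ : 2 ≤ s
  · exact isSumOfThree_six_five_five (a := d₅ - 1) (b := d₄ + g - 1 - s) (s := s) (k₁ := k₁)
      (k₅ := 1) hg h₁ h₂ h₃ (by omega) (by omega) (by omega) hs₂ (by omega) (by omega) (by omega)
      (by omega)
  have hk₁ : k₁ < 1 := carry_lt c₀ (by omega)
  obtain rfl : k₁ = 0 := by omega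
  rcases Nat.lt_or_ge d₅ 3 with h₅₂' | h₅₃
  · obtain rfl : d₅ = 2 := by omega
    exact isSumOfThree_leading_two hg h₁ h₂ h₃ (by omega)
  · exact isSumOfThree_six_five_five (a := d₅ - 2) (b := d₄ + g - 2 - s) (s := s + g + 1)
      (k₁ := 1) (k₅ := 2) hg h₁ h₂ h₃ (by omega) (by omega) (by omega) (by omega) (by omega)
      (by omega) (by omega) (by omega)

end

theorem six_digit_sum_three_palindromes (g : ℕ) (hg : 5 ≤ g) (n : ℕ)
    (h1 : g ^ 5 ≤ n) (h2 : n ≤ g ^ 6 - 1) :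
    ∃ p q r : ℕ, IsBasePalindrome g p ∧ IsBasePalindrome g q ∧ IsBasePalindrome g r ∧
      n = p + q + r := by
  have hg₀ : 0 < g := by omega
  have hn : n = n % g + n / g % g * g + n / g / g % g * g ^ 2 + n / g / g / g % g * g ^ 3 +
      n / g / g / g / g % g * g ^ 4 + n / g / g / g / g / g * g ^ 5 := by
    have e₀ := Nat.mod_add_div n g
    have e₁ := Nat.mod_add_div (n / g) g
    have e₂ := Nat.mod_add_div (n / g / g) g
    have e₃ := Nat.mod_add_div (n / g / g / g) g
    have e₄ := Nat.mod_add_div (n / g / g / g / g) g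
    zify at *
    linear_combination -e₀ - g * e₁ - g ^ 2 * e₂ - g ^ 3 * e₃ - g ^ 4 * e₄
  have hd : n / g / g / g / g / g = n / g ^ 5 := by
    simp only [Nat.div_div_eq_div_mul]
    ring_nf
  rw [hn]
  refine isSumOfThree_of_digits hg (Nat.mod_lt _ hg₀) (Nat.mod_lt _ hg₀) (Nat.mod_lt _ hg₀)
    (Nat.mod_lt _ hg₀) (Nat.mod_lt _ hg₀) ?_ ?_
  · rw [hd]
    exact Nat.div_pos h1 (by positivity)
  · rw [hd, Nat.div_lt_iff_lt_mul (by positivity)]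
    have : 0 < g ^ 6 := by positivity
    have : g ^ 6 = g * g ^ 5 := by ring
    omega
end

section
/- Let g ≥ 5. Every positive integer n with fewer than seven base g digits (i.e., 1 ≤ n < g⁶) is a sum of three base g palindromes. -/
/-- `n` is a sum of three base `g` palindromes. -/
def IsSumOfThreePalindromes (g n : ℕ) : Prop :=
  ∃ p q r : ℕ, IsBasePalindrome g p ∧ IsBasePalindrome g q ∧ IsBasePalindrome g r ∧ n = p + q + r

namespace IsBasePalindrome

variable {g : ℕ}

theorem zero (g : ℕ) : IsBasePalindrome g 0 := by simp [IsBasePalindrome]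

theorem one_digit (a : ℕ) (ha : a < g := by omega) : IsBasePalindrome g a := by
  rcases Nat.eq_zero_or_pos a with rfl | h
  · exact zero g
  · simp [IsBasePalindrome, Nat.digits_of_lt g a h.ne' ha]

theorem ofDigits (hg : 1 < g) (L : List ℕ) (hL : ∀ d ∈ L, d < g)
    (h0 : ∀ h : L ≠ [], L.getLast h ≠ 0) (hr : L.reverse = L) :
    IsBasePalindrome g (Nat.ofDigits g L) := by
  rw [IsBasePalindrome, Nat.digits_ofDigits g hg L hL h0, hr]

theorem two_digits (a : ℕ) (ha : a < g := by omega) : IsBasePalindrome g (a * (g + 1)) := by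
  rcases Nat.eq_zero_or_pos a with rfl | h
  · simpa using zero g
  · have hg : 1 < g := by omega
    convert ofDigits hg [a, a] (by simpa using ha) (by simpa using h.ne') (by simp) using 1
    simp [Nat.ofDigits_cons]; ring

theorem three_digits (a b : ℕ) (ha : 0 < a := by omega) (ha' : a < g := by omega)
    (hb : b < g := by omega) : IsBasePalindrome g (a * (g ^ 2 + 1) + b * g) := by
  have hg : 1 < g := by omega
  convert ofDigits hg [a, b, a] (by simp; omega) (by simpa using ha.ne') (by simp) using 1
  simp [Nat.ofDigits_cons]; ring

theorem four_digits (a b : ℕ) (ha : 0 < a := by omega) (ha' : a < g := by omega)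
    (hb : b < g := by omega) : IsBasePalindrome g (a * (g ^ 3 + 1) + b * (g ^ 2 + g)) := by
  have hg : 1 < g := by omega
  convert ofDigits hg [a, b, b, a] (by simp; omega) (by simpa using ha.ne') (by simp) using 1
  simp [Nat.ofDigits_cons]; ring

theorem five_digits (a b c : ℕ) (ha : 0 < a := by omega) (ha' : a < g := by omega)
    (hb : b < g := by omega) (hc : c < g := by omega) :
    IsBasePalindrome g (a * (g ^ 4 + 1) + b * (g ^ 3 + g) + c * g ^ 2) := by
  have hg : 1 < g := by omega
  convert ofDigits hg [a, b, c, b, a] (by simp; omega) (by simpa using ha.ne') (by simp) using 1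
  simp [Nat.ofDigits_cons]; ring

theorem six_digits (a b c : ℕ) (ha : 0 < a := by omega) (ha' : a < g := by omega)
    (hb : b < g := by omega) (hc : c < g := by omega) :
    IsBasePalindrome g (a * (g ^ 5 + 1) + b * (g ^ 4 + g) + c * (g ^ 3 + g ^ 2)) := by
  have hg : 1 < g := by omega
  convert ofDigits hg [a, b, c, c, b, a] (by simp; omega) (by simpa using ha.ne') (by simp) using 1
  simp [Nat.ofDigits_cons]; ring

end IsBasePalindrome

open IsBasePalindrome

variable {g : ℕ}

theorem exists_two_digits {n : ℕ} (hn : n < g ^ 2) :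
    ∃ x y : ℕ, x < g ∧ y < g ∧ n = x * g + y := by
  have hg : 0 < g := by
    rcases Nat.eq_zero_or_pos g with rfl | h
    · simp at hn
    · exact h
  exact ⟨n / g, n % g, Nat.div_lt_of_lt_mul (by rwa [sq] at hn), Nat.mod_lt _ hg,
    (Nat.div_add_mod' n g).symm⟩

theorem exists_leading_digit {n k : ℕ} (hn : n < g ^ (k + 1)) :
    ∃ d R : ℕ, d < g ∧ R < g ^ k ∧ n = d * g ^ k + R := by
  have hg : 0 < g := by
    rcases Nat.eq_zero_or_pos g with rfl | h
    · simp at hn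
    · exact h
  exact ⟨n / g ^ k, n % g ^ k, Nat.div_lt_of_lt_mul (by rwa [pow_succ] at hn),
    Nat.mod_lt _ (by positivity), (Nat.div_add_mod' n _).symm⟩

/-- Apart from two exceptional families, numbers with at most three digits are sums of two
palindromes. -/
theorem sum_two_or_exceptional (hg : 5 ≤ g) {n : ℕ} (hn : n < g ^ 3) :
    (∃ q r : ℕ, IsBasePalindrome g q ∧ IsBasePalindrome g r ∧ n = q + r) ∨
      (∃ d : ℕ, 1 ≤ d ∧ d + 2 ≤ g ∧ n = (d + 1) * g + d) ∨
      ∃ k : ℕ, 1 ≤ k ∧ k + 2 ≤ g ∧ n = (k + 1) * g ^ 2 + k := by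
  obtain ⟨z, m, hz, hm, rfl⟩ := exists_leading_digit (k := 2) hn
  obtain ⟨x, y, hx, hy, rfl⟩ := exists_two_digits hm
  rcases Nat.eq_zero_or_pos z with rfl | hz0
  · rcases Nat.lt_or_ge y x with h | h
    · obtain ⟨x, rfl⟩ : ∃ w, x = w + 1 := ⟨x - 1, by omega⟩
      rcases Nat.eq_or_lt_of_le h with h1 | h1
      · rcases Nat.eq_zero_or_pos y with rfl | hy0
        · obtain rfl : x = 0 := by omega
          exact Or.inl ⟨_, _, one_digit (g - 1), one_digit 1, by
            rw [Nat.sub_add_cancel (by omega)]; ring⟩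
        · obtain rfl : y = x := by omega
          exact Or.inr (Or.inl ⟨y, hy0, by omega, by ring⟩)
      · obtain ⟨w, hw⟩ : ∃ w, w + x = g + y := ⟨g + y - x, by omega⟩
        exact Or.inl ⟨_, _, two_digits x, one_digit w, by grind⟩
    · obtain ⟨w, rfl⟩ : ∃ w, y = w + x := ⟨y - x, by omega⟩
      exact Or.inl ⟨_, _, two_digits x, one_digit w, by ring⟩
  · rcases Nat.lt_or_ge y z with h | h
    · obtain ⟨w, hw⟩ : ∃ w, w + z = g + y := ⟨g + y - z, by omega⟩
      rcases Nat.eq_zero_or_pos x with rfl | hx0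
      · obtain ⟨z, rfl⟩ : ∃ w, z = w + 1 := ⟨z - 1, by omega⟩
        rcases Nat.eq_zero_or_pos z with rfl | hz1
        · obtain rfl : y = 0 := by omega
          obtain ⟨u, hu⟩ : ∃ u, u + 1 = g := ⟨g - 1, by omega⟩
          exact Or.inl ⟨_, _, two_digits u, one_digit 1, by grind⟩
        · rcases Nat.eq_or_lt_of_le h with h1 | h1
          · obtain rfl : y = z := by omega
            exact Or.inr (Or.inr ⟨y, hz1, by omega, by ring⟩)
          · obtain ⟨u, hu⟩ : ∃ u, u + 1 = g := ⟨g - 1, by omega⟩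
            exact Or.inl ⟨_, _, three_digits z u, one_digit (w + 1), by grind⟩
      · obtain ⟨x, rfl⟩ : ∃ w, x = w + 1 := ⟨x - 1, by omega⟩
        exact Or.inl ⟨_, _, three_digits z x, one_digit w, by grind⟩
    · obtain ⟨w, rfl⟩ : ∃ w, y = w + z := ⟨y - z, by omega⟩
      exact Or.inl ⟨_, _, three_digits z x, one_digit w, by ring⟩

namespace IsSumOfThreePalindromes

theorem of_lt_pow_three (hg : 5 ≤ g) {n : ℕ} (hn : n < g ^ 3) : IsSumOfThreePalindromes g n := by
  obtain ⟨u, hu⟩ : ∃ u, u + 1 = g := ⟨g - 1, by omega⟩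
  rcases sum_two_or_exceptional hg hn with
    ⟨q, r, hq, hr, rfl⟩ | ⟨d, hd, hd', rfl⟩ | ⟨k, hk, hk', rfl⟩
  · exact ⟨_, _, _, zero g, hq, hr, by ring⟩
  · exact ⟨_, _, _, two_digits d, one_digit u, one_digit 1, by grind⟩
  · exact ⟨_, _, _, three_digits k u, one_digit u, one_digit 1, by grind⟩

theorem of_four_digits (hg : 5 ≤ g) {a R : ℕ} (ha : 0 < a) (ha' : a < g) (hR : R < g ^ 3) :
    IsSumOfThreePalindromes g (a * g ^ 3 + R) := by
  obtain ⟨u, hu⟩ : ∃ u, u + 1 = g := ⟨g - 1, by omega⟩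
  rcases Nat.lt_or_ge R a with h | h
  · obtain ⟨a, rfl⟩ : ∃ w, a = w + 1 := ⟨a - 1, by omega⟩
    rcases Nat.eq_zero_or_pos a with rfl | ha0
    · obtain rfl : R = 0 := by omega
      exact ⟨_, _, _, zero g, three_digits u u, one_digit 1, by grind⟩
    · have h3 : 5 * g ^ 2 ≤ g ^ 3 := by rw [pow_succ' g 2]; gcongr
      have h2 : 5 * g ≤ g ^ 2 := by rw [sq]; gcongr
      obtain ⟨W, hW⟩ : ∃ W, W + (a + g ^ 2 + g) = g ^ 3 + R :=
        ⟨g ^ 3 + R - (a + g ^ 2 + g), by omega⟩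
      rcases sum_two_or_exceptional (n := W) hg (by omega) with
        ⟨q, r, hq, hr, rfl⟩ | ⟨d, hd, hd', rfl⟩ | ⟨k, hk, hk', rfl⟩
      · exact ⟨_, _, _, four_digits a 1, hq, hr, by grind⟩
      · nlinarith
      · exfalso
        rcases Nat.eq_or_lt_of_le hk' with rfl | hk'
        · grind
        · have : (k + 3) * g ^ 2 ≤ g ^ 3 := by rw [pow_succ' g 2]; gcongr; omega
          nlinarith
  · obtain ⟨W, rfl⟩ : ∃ W, R = W + a := ⟨R - a, by omega⟩
    rcases sum_two_or_exceptional (n := W) hg (by omega) with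
      ⟨q, r, hq, hr, rfl⟩ | ⟨d, hd, hd', rfl⟩ | ⟨k, hk, hk', rfl⟩
    · exact ⟨_, _, _, four_digits a 0, hq, hr, by ring⟩
    · obtain ⟨a, rfl⟩ : ∃ w, a = w + 1 := ⟨a - 1, by omega⟩
      rcases Nat.eq_zero_or_pos a with rfl | ha0
      · exact ⟨_, _, _, three_digits u u, two_digits (d + 1), one_digit 1, by grind⟩
      · rcases Nat.lt_or_ge (d + 1) u with h1 | h1
        · obtain ⟨d, rfl⟩ : ∃ w, d = w + 1 := ⟨d - 1, by omega⟩
          exact ⟨_, _, _, four_digits a 1, three_digits u d, one_digit (d + 3), by grind⟩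
        · obtain rfl : u = d + 1 := by omega
          exact ⟨_, _, _, four_digits a 1, three_digits (d + 1) d, zero g, by grind⟩
    · obtain ⟨k, rfl⟩ : ∃ w, k = w + 1 := ⟨k - 1, by omega⟩
      rcases Nat.eq_zero_or_pos k with rfl | hk0
      · obtain ⟨t, ht⟩ : ∃ t, t + 2 = g := ⟨g - 2, by omega⟩
        exact ⟨_, _, _, four_digits a 1, two_digits t, one_digit 3, by grind⟩
      · exact ⟨_, _, _, four_digits a 1, three_digits k u, one_digit 1, by grind⟩

theorem of_five_digits (hg : 5 ≤ g) {a b R : ℕ} (ha : 0 < a) (ha' : a < g) (hb : b < g)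
    (hR : R < g ^ 3) : IsSumOfThreePalindromes g (a * g ^ 4 + b * g ^ 3 + R) := by
  obtain ⟨u, hu⟩ : ∃ u, u + 1 = g := ⟨g - 1, by omega⟩
  have h3 : 5 * g ^ 2 ≤ g ^ 3 := by rw [pow_succ' g 2]; gcongr
  have h2 : 5 * g ≤ g ^ 2 := by rw [sq]; gcongr
  have h4 : (b + 1) * g ≤ g ^ 2 := by rw [sq]; gcongr; omega
  rcases Nat.lt_or_ge R (a + b * g) with h | h
  · rcases Nat.eq_zero_or_pos b with rfl | hb0
    · obtain ⟨a, rfl⟩ : ∃ w, a = w + 1 := ⟨a - 1, by omega⟩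
      rcases Nat.eq_zero_or_pos a with rfl | ha0
      · obtain rfl : R = 0 := by omega
        exact ⟨_, _, _, zero g, four_digits u u, one_digit 1, by grind⟩
      · obtain ⟨W, hW⟩ : ∃ W, W + (a + g ^ 2) = g ^ 3 + g + R :=
          ⟨g ^ 3 + g + R - (a + g ^ 2), by omega⟩
        rcases sum_two_or_exceptional (n := W) hg (by omega) with
          ⟨q, r, hq, hr, rfl⟩ | ⟨d, hd, hd', rfl⟩ | ⟨k, hk, hk', rfl⟩
        · exact ⟨_, _, _, five_digits a u 0, hq, hr, by grind⟩
        · nlinarith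
        · exact ⟨_, _, _, five_digits a u 1, three_digits k 0, zero g, by grind⟩
    · obtain ⟨b, rfl⟩ : ∃ w, b = w + 1 := ⟨b - 1, by omega⟩
      obtain ⟨W, hW⟩ : ∃ W, W + (a + b * g + g ^ 2) = g ^ 3 + R :=
        ⟨g ^ 3 + R - (a + b * g + g ^ 2), by grind⟩
      rcases sum_two_or_exceptional (n := W) hg (by grind) with
        ⟨q, r, hq, hr, rfl⟩ | ⟨d, hd, hd', rfl⟩ | ⟨k, hk, hk', rfl⟩
      · exact ⟨_, _, _, five_digits a b 1, hq, hr, by grind⟩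
      · nlinarith
      · exact ⟨_, _, _, five_digits a b 2, three_digits k 0, zero g, by grind⟩
  · obtain ⟨W, rfl⟩ : ∃ W, R = W + (a + b * g) := ⟨R - (a + b * g), by omega⟩
    rcases sum_two_or_exceptional (n := W) hg (by omega) with
      ⟨q, r, hq, hr, rfl⟩ | ⟨d, hd, hd', rfl⟩ | ⟨k, hk, hk', rfl⟩
    · exact ⟨_, _, _, five_digits a b 0, hq, hr, by ring⟩
    · rcases Nat.eq_zero_or_pos b with rfl | hb0
      · obtain ⟨a, rfl⟩ : ∃ w, a = w + 1 := ⟨a - 1, by omega⟩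
        rcases Nat.eq_zero_or_pos a with rfl | ha0
        · exact ⟨_, _, _, four_digits u u, two_digits (d + 1), one_digit 1, by grind⟩
        · rcases Nat.lt_or_ge (d + 1) u with h1 | h1
          · obtain ⟨t, ht⟩ : ∃ t, t + 2 = g := ⟨g - 2, by omega⟩
            exact ⟨_, _, _, five_digits a u t, three_digits 1 (d + 2), one_digit d, by grind⟩
          · obtain rfl : u = d + 1 := by omega
            exact ⟨_, _, _, five_digits a (d + 1) 1, three_digits (d + 1) 0, zero g, by grind⟩
      · obtain ⟨b, rfl⟩ : ∃ w, b = w + 1 := ⟨b - 1, by omega⟩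
        rcases Nat.lt_or_ge (d + 1) u with h1 | h1
        · obtain ⟨v, hv⟩ : ∃ v, v + u = g + d := ⟨d + g - u, by omega⟩
          exact ⟨_, _, _, five_digits a b 1, three_digits u (d + 1), one_digit v, by grind⟩
        · obtain rfl : u = d + 1 := by omega
          exact ⟨_, _, _, five_digits a b 3, three_digits d 0, zero g, by grind⟩
    · exact ⟨_, _, _, five_digits a b 1, three_digits k 0, zero g, by grind⟩

theorem six_digits_add_of_ascending (hg : 5 ≤ g) {a b D d : ℕ} (ha : 0 < a) (ha' : a < g)
    (hb : b < g) (hD : D < g) (hd : 1 ≤ d) (hd' : d + 2 ≤ g) :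
    IsSumOfThreePalindromes g
      (a * (g ^ 5 + 1) + b * (g ^ 4 + g) + D * (g ^ 3 + g ^ 2) + ((d + 1) * g + d)) := by
  obtain ⟨u, hu⟩ : ∃ u, u + 1 = g := ⟨g - 1, by omega⟩
  obtain ⟨a, rfl⟩ : ∃ w, a = w + 1 := ⟨a - 1, by omega⟩
  rcases Nat.eq_zero_or_pos D with rfl | hD0
  · rcases Nat.eq_zero_or_pos b with rfl | hb0
    · rcases Nat.eq_zero_or_pos a with rfl | ha0
      · exact ⟨_, _, _, five_digits u u u, two_digits (d + 1), one_digit 1, by grind⟩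
      · obtain ⟨e, he⟩ : ∃ e, e + d + 1 = g := ⟨g - d - 1, by omega⟩
        rcases Nat.lt_or_ge (2 * d + 1) g with h | h
        · exact ⟨_, _, _, six_digits a d 0, five_digits (e + 1) 0 0, one_digit (2 * d + 1),
            by grind⟩
        · obtain ⟨w, hw⟩ : ∃ w, w + g = 2 * d + 2 := ⟨2 * d + 2 - g, by omega⟩
          exact ⟨_, _, _, six_digits a (d + 1) 0, five_digits e 0 0, one_digit w, by grind⟩
    · obtain ⟨b, rfl⟩ : ∃ w, b = w + 1 := ⟨b - 1, by omega⟩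
      rcases Nat.lt_or_ge (d + 1) u with h | h
      · obtain ⟨e, rfl⟩ : ∃ w, d = w + 1 := ⟨d - 1, by omega⟩
        exact ⟨_, _, _, six_digits (a + 1) b u, three_digits 1 (e + 3), one_digit e, by grind⟩
      · obtain rfl : u = d + 1 := by omega
        obtain ⟨e, rfl⟩ : ∃ w, d = w + 2 := ⟨d - 2, by omega⟩
        exact ⟨_, _, _, six_digits (a + 1) b (e + 3), three_digits 2 0, one_digit e, by grind⟩
  obtain ⟨D, rfl⟩ : ∃ w, D = w + 1 := ⟨D - 1, by omega⟩
  rcases Nat.eq_zero_or_pos b with rfl | hb0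
  · rcases Nat.eq_zero_or_pos a with rfl | ha0
    · rcases Nat.lt_or_ge d D with h | h
      · obtain ⟨m, hm⟩ : ∃ m, m + D = g + d := ⟨g + d - D, by omega⟩
        obtain ⟨H, hH⟩ : ∃ H, H + d = D := ⟨D - d, by omega⟩
        exact ⟨_, _, _, five_digits u D u, five_digits 1 0 H, three_digits (d + 1) m, by grind⟩
      · obtain ⟨m, rfl⟩ : ∃ m, d = m + D := ⟨d - D, by omega⟩
        obtain ⟨H, hH⟩ : ∃ H, H + m = u := ⟨u - m, by omega⟩
        exact ⟨_, _, _, five_digits u D H, five_digits 1 0 1, three_digits (m + D + 1) m, by grind⟩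
    · rcases Nat.lt_or_ge (d + 1) u with h | h
      · obtain ⟨H, hH⟩ : ∃ H, H + d = g := ⟨g - d, by omega⟩
        exact ⟨_, _, _, six_digits a u D, five_digits 1 0 H, three_digits d (d + 2), by grind⟩
      · obtain rfl : u = d + 1 := by omega
        exact ⟨_, _, _, six_digits a (d + 1) D, five_digits 1 0 3, three_digits d 0, by grind⟩
  obtain ⟨b, rfl⟩ : ∃ w, b = w + 1 := ⟨b - 1, by omega⟩
  obtain rfl | rfl | hd3 : d = 1 ∨ d = 2 ∨ 3 ≤ d := by omega
  · rcases Nat.eq_zero_or_pos b with rfl | hb1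
    · rcases Nat.eq_zero_or_pos a with rfl | ha0
      · rcases Nat.lt_or_ge 2 D with h | h
        · obtain ⟨m, hm⟩ : ∃ m, m + D = g + 2 := ⟨g + 2 - D, by omega⟩
          exact ⟨_, _, _, five_digits u D u, five_digits 2 0 D, three_digits 1 m, by grind⟩
        · obtain ⟨m, hm⟩ : ∃ m, m + D = 2 := ⟨2 - D, by omega⟩
          exact ⟨_, _, _, five_digits u D u, five_digits 2 0 (D + 1), three_digits 1 m, by grind⟩
      · obtain ⟨t, ht⟩ : ∃ t, t + 2 = g := ⟨g - 2, by omega⟩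
        exact ⟨_, _, _, six_digits a t D, five_digits 3 0 1, three_digits u 4, by grind⟩
    · obtain ⟨b, rfl⟩ : ∃ w, b = w + 1 := ⟨b - 1, by omega⟩
      exact ⟨_, _, _, six_digits (a + 1) b D, five_digits 2 0 2, three_digits u 3, by grind⟩
  · exact ⟨_, _, _, six_digits (a + 1) b D, five_digits 1 1 0, three_digits 1 3, by grind⟩
  obtain ⟨e, rfl⟩ : ∃ w, d = w + 1 := ⟨d - 1, by omega⟩
  rcases Nat.lt_or_ge (e + 2) u with h | h
  · obtain ⟨H, hH⟩ : ∃ H, H + e = g + 1 := ⟨g + 1 - e, by omega⟩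
    exact ⟨_, _, _, six_digits (a + 1) b D, five_digits 1 0 H, three_digits e (e + 3), by grind⟩
  obtain rfl : u = e + 2 := by omega
  rcases Nat.eq_or_lt_of_le hg with rfl | hg6
  · obtain rfl : e = 2 := by omega
    rcases Nat.eq_zero_or_pos D with rfl | hD1
    · rcases Nat.eq_zero_or_pos b with rfl | hb1
      · rcases Nat.eq_zero_or_pos a with rfl | ha0
        · exact ⟨_, _, _, five_digits 4 0 3, five_digits 2 0 0, three_digits 3 4, by norm_num⟩
        · exact ⟨_, _, _, six_digits a 4 0, five_digits 2 0 4, three_digits 2 1, by omega⟩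
      · obtain ⟨b, rfl⟩ : ∃ w, b = w + 1 := ⟨b - 1, by omega⟩
        exact ⟨_, _, _, six_digits (a + 1) b 1, five_digits 2 0 0, three_digits 1 1, by omega⟩
    · obtain ⟨D, rfl⟩ : ∃ w, D = w + 1 := ⟨D - 1, by omega⟩
      exact ⟨_, _, _, six_digits (a + 1) b D, five_digits 1 2 0, three_digits 2 3, by omega⟩
  · exact ⟨_, _, _, six_digits (a + 1) b D, five_digits 1 0 5, three_digits e 0, by grind⟩

theorem six_digits_add_of_zero_middle (hg : 5 ≤ g) {a b D k : ℕ} (ha : 0 < a) (ha' : a < g)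
    (hb : b < g) (hD : D < g) (hk : 1 ≤ k) (hk' : k + 2 ≤ g) :
    IsSumOfThreePalindromes g
      (a * (g ^ 5 + 1) + b * (g ^ 4 + g) + D * (g ^ 3 + g ^ 2) + ((k + 1) * g ^ 2 + k)) := by
  obtain ⟨u, hu⟩ : ∃ u, u + 1 = g := ⟨g - 1, by omega⟩
  obtain ⟨t, ht⟩ : ∃ t, t + 2 = g := ⟨g - 2, by omega⟩
  obtain ⟨a, rfl⟩ : ∃ w, a = w + 1 := ⟨a - 1, by omega⟩
  obtain ⟨k, rfl⟩ : ∃ w, k = w + 1 := ⟨k - 1, by omega⟩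
  rcases Nat.eq_zero_or_pos b with rfl | hb0
  · rcases Nat.eq_zero_or_pos D with rfl | hD0
    · rcases Nat.eq_zero_or_pos a with rfl | ha0
      · exact ⟨_, _, _, five_digits u u u, one_digit 1, three_digits (k + 2) 0, by grind⟩
      · exact ⟨_, _, _, six_digits a u u, three_digits (k + 2) 1, zero g, by grind⟩
    · obtain ⟨D, rfl⟩ : ∃ w, D = w + 1 := ⟨D - 1, by omega⟩
      rcases Nat.eq_zero_or_pos k with rfl | hk0
      · rcases Nat.eq_zero_or_pos a with rfl | ha0
        · obtain ⟨m, hm⟩ : ∃ m, m + D = t := ⟨t - D, by omega⟩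
          exact ⟨_, _, _, five_digits u (D + 1) D, five_digits 1 0 0, three_digits 2 m, by grind⟩
        · exact ⟨_, _, _, six_digits a u (D + 1), five_digits 1 0 0, three_digits 1 1, by grind⟩
      · exact ⟨_, _, _, six_digits (a + 1) 0 D, four_digits 1 2, three_digits k t, by grind⟩
  · obtain ⟨b, rfl⟩ : ∃ w, b = w + 1 := ⟨b - 1, by omega⟩
    rcases Nat.eq_zero_or_pos k with rfl | hk0
    · rcases Nat.eq_zero_or_pos D with rfl | hD0
      · exact ⟨_, _, _, six_digits (a + 1) b u, three_digits 3 0, one_digit t, by grind⟩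
      · obtain ⟨D, rfl⟩ : ∃ w, D = w + 1 := ⟨D - 1, by omega⟩
        exact ⟨_, _, _, six_digits (a + 1) b D, five_digits 1 1 3, zero g, by grind⟩
    · exact ⟨_, _, _, six_digits (a + 1) b D, five_digits 1 0 2, three_digits k 1, by grind⟩

/-- A number whose excess over a six-digit palindrome has at most three digits is a sum of three
palindromes. -/
theorem six_digits_add_lt_pow_three (hg : 5 ≤ g) {a b D R : ℕ} (ha : 0 < a) (ha' : a < g)
    (hb : b < g) (hD : D < g) (hR : R < g ^ 3) :
    IsSumOfThreePalindromes g
      (a * (g ^ 5 + 1) + b * (g ^ 4 + g) + D * (g ^ 3 + g ^ 2) + R) := by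
  rcases sum_two_or_exceptional hg hR with
    ⟨q, r, hq, hr, rfl⟩ | ⟨d, hd, hd', rfl⟩ | ⟨k, hk, hk', rfl⟩
  · exact ⟨_, _, _, six_digits a b D, hq, hr, by ring⟩
  · exact six_digits_add_of_ascending hg ha ha' hb hD hd hd'
  · exact six_digits_add_of_zero_middle hg ha ha' hb hD hk hk'

/-- Numbers with leading digit `1` and excess `g ^ 3 + x * g + y` over a six-digit palindrome, as
sums of two five-digit palindromes and a three-digit one. -/
theorem one_six_digits_add (hg : 5 ≤ g) {b D x y k : ℕ} (hb : b < 3) (hD : D + 1 < g)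
    (hxb : x + b ≤ g + D) (hk : 0 < k) (hk' : k < g) (hy : k + b = y + 1) :
    IsSumOfThreePalindromes g
      (1 * (g ^ 5 + 1) + b * (g ^ 4 + g) + D * (g ^ 3 + g ^ 2) + (g ^ 3 + x * g + y)) := by
  obtain ⟨u, hu⟩ : ∃ u, u + 1 = g := ⟨g - 1, by omega⟩
  rcases Nat.lt_or_ge D (x + b) with h | h
  · obtain ⟨m, hm⟩ : ∃ m, m + D + 1 = x + b := ⟨x + b - D - 1, by omega⟩
    obtain ⟨H, H', hH, hH', hs⟩ : ∃ H H', H < g ∧ H' < g ∧ H + H' + k = g + D :=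
      ⟨min (g + D - k) u, g + D - k - u, by omega⟩
    exact ⟨_, _, _, five_digits u D H, five_digits (b + 1) 0 H', three_digits k m, by grind⟩
  · obtain ⟨m, hm⟩ : ∃ m, m + D + 1 = g + x + b := ⟨g + x + b - D - 1, by omega⟩
    obtain ⟨H, H', hH, hH', hs⟩ : ∃ H H', H < g ∧ H' < g ∧ H + H' + k = u + D :=
      ⟨min (u + D - k) u, u + D - k - u, by omega⟩
    exact ⟨_, _, _, five_digits u D H, five_digits (b + 1) 0 H', three_digits k m, by grind⟩

theorem six_digits_add_pow_three_add (hg : 5 ≤ g) {a b D x y : ℕ} (ha : 0 < a) (ha' : a < g)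
    (hb : b < g) (hD : D + 1 < g) (hx : x < g) (hy : y < g) :
    IsSumOfThreePalindromes g
      (a * (g ^ 5 + 1) + b * (g ^ 4 + g) + D * (g ^ 3 + g ^ 2) + (g ^ 3 + x * g + y)) := by
  obtain ⟨u, hu⟩ : ∃ u, u + 1 = g := ⟨g - 1, by omega⟩
  obtain ⟨t, ht⟩ : ∃ t, t + 2 = g := ⟨g - 2, by omega⟩
  rcases Nat.eq_zero_or_pos y with rfl | hy0
  · rcases Nat.eq_zero_or_pos x with rfl | hx0
    · exact ⟨_, _, _, six_digits a b D, three_digits u u, one_digit 1, by grind⟩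
    · obtain ⟨x, rfl⟩ : ∃ w, x = w + 1 := ⟨x - 1, by omega⟩
      exact ⟨_, _, _, six_digits a b D, three_digits u x, three_digits 1 0, by grind⟩
  obtain ⟨a, rfl⟩ : ∃ w, a = w + 1 := ⟨a - 1, by omega⟩
  obtain ⟨y, rfl⟩ : ∃ w, y = w + 1 := ⟨y - 1, by omega⟩
  obtain ⟨v, hv⟩ : ∃ v, v + y = g := ⟨g - y, by omega⟩
  rcases Nat.eq_zero_or_pos b with rfl | hb0
  · rcases Nat.eq_zero_or_pos a with rfl | ha0
    · rcases Nat.eq_or_lt_of_le hy with hyg | hyg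
      · obtain rfl : y = t := by omega
        rcases Nat.lt_or_ge x D with h | h
        · obtain ⟨m, hm⟩ : ∃ m, m + D = g + x := ⟨g + x - D, by omega⟩
          obtain ⟨D, rfl⟩ : ∃ w, D = w + 1 := ⟨D - 1, by omega⟩
          exact ⟨_, _, _, five_digits y u y, five_digits 1 (D + 2) D, three_digits 1 m, by grind⟩
        · obtain ⟨m, rfl⟩ : ∃ m, x = m + D := ⟨x - D, by omega⟩
          exact ⟨_, _, _, five_digits y u y, five_digits 1 (D + 1) D, three_digits 1 m, by grind⟩
      · exact one_six_digits_add hg (k := y + 2) (by omega) hD (by omega) (by omega) hyg rfl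
    · obtain ⟨w, hw⟩ : ∃ w, w + 1 = v := ⟨v - 1, by omega⟩
      rcases Nat.lt_or_ge x u with h | h
      · obtain ⟨s, hs⟩ : ∃ s, s + 1 = w := ⟨w - 1, by omega⟩
        exact ⟨_, _, _, six_digits a u D, five_digits 1 0 s, three_digits (y + 1) (x + 1),
          by grind⟩
      · obtain rfl : x = u := by omega
        exact ⟨_, _, _, six_digits a x D, five_digits 1 0 w, three_digits (y + 1) 0, by grind⟩
  obtain ⟨b, rfl⟩ : ∃ w, b = w + 1 := ⟨b - 1, by omega⟩
  rcases Nat.eq_zero_or_pos y with rfl | hy1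
  · rcases Nat.eq_zero_or_pos b with rfl | hb1
    · rcases Nat.eq_zero_or_pos a with rfl | ha0
      · exact one_six_digits_add hg (k := 1) (by omega) hD (by omega) (by omega) (by omega) rfl
      · obtain h | rfl | rfl : x + 2 < g ∨ x = t ∨ x = u := by omega
        · exact ⟨_, _, _, six_digits a t D, five_digits 3 0 0, three_digits u (x + 2), by grind⟩
        · exact ⟨_, _, _, six_digits a x D, five_digits 3 0 1, three_digits u 0, by grind⟩
        · exact ⟨_, _, _, six_digits a t D, five_digits 3 0 1, three_digits x 1, by grind⟩
    · obtain ⟨b, rfl⟩ : ∃ w, b = w + 1 := ⟨b - 1, by omega⟩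
      rcases Nat.lt_or_ge x u with h | h
      · exact ⟨_, _, _, six_digits (a + 1) b D, five_digits 2 0 1, three_digits u (x + 1),
          by grind⟩
      · obtain rfl : x = u := by omega
        exact ⟨_, _, _, six_digits (a + 1) b D, five_digits 2 0 2, three_digits x 0, by grind⟩
  rcases Nat.lt_or_ge x u with h | h
  · exact ⟨_, _, _, six_digits (a + 1) b D, five_digits 1 0 v, three_digits y (x + 1), by grind⟩
  obtain rfl : x = u := by omega
  rcases Nat.eq_or_lt_of_le hy1 with rfl | hy2
  · obtain rfl | rfl | hb2 : b = 0 ∨ b = 1 ∨ 2 ≤ b := by omega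
    · rcases Nat.eq_zero_or_pos a with rfl | ha0
      · exact one_six_digits_add hg (k := 2) (by omega) hD (by omega) (by omega) (by omega) rfl
      · exact ⟨_, _, _, six_digits a x D, five_digits 2 0 x, three_digits 1 1, by grind⟩
    · rcases Nat.eq_zero_or_pos a with rfl | ha0
      · rcases Nat.eq_zero_or_pos D with rfl | hD0
        · exact ⟨_, _, _, five_digits x 0 x, five_digits 3 0 1, three_digits 1 0, by grind⟩
        · exact one_six_digits_add hg (k := 1) (by omega) hD (by omega) (by omega) (by omega) rfl
      · exact ⟨_, _, _, six_digits a t D, five_digits 4 0 1, three_digits x 2, by grind⟩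
    · obtain ⟨b, rfl⟩ : ∃ w, b = w + 2 := ⟨b - 2, by omega⟩
      exact ⟨_, _, _, six_digits (a + 1) b D, five_digits 3 0 2, three_digits x 1, by grind⟩
  · exact ⟨_, _, _, six_digits (a + 1) b D, five_digits 1 0 (v + 1), three_digits y 0, by grind⟩

theorem of_six_digits (hg : 5 ≤ g) {a b D R : ℕ} (ha : 0 < a) (ha' : a < g) (hb : b < g)
    (hD : D < g) (hR : R < g ^ 3) :
    IsSumOfThreePalindromes g (a * g ^ 5 + b * g ^ 4 + D * g ^ 3 + R) := by
  have h2 : (b + 1) * g ≤ g ^ 2 := by rw [sq]; gcongr; omega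
  have h3 : (D + 1) * g ^ 2 ≤ g ^ 3 := by rw [pow_succ' g 2]; gcongr; omega
  have h4 : 5 * g ^ 2 ≤ g ^ 3 := by rw [pow_succ' g 2]; gcongr
  have h5 : 5 * g ≤ g ^ 2 := by rw [sq]; gcongr
  rcases Nat.lt_or_ge R (a + b * g + D * g ^ 2) with h | h
  · rcases Nat.eq_zero_or_pos D with rfl | hD0
    · obtain ⟨u, hu⟩ : ∃ u, u + 1 = g := ⟨g - 1, by omega⟩
      rcases Nat.eq_zero_or_pos b with rfl | hb0
      · obtain ⟨a, rfl⟩ : ∃ w, a = w + 1 := ⟨a - 1, by omega⟩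
        rcases Nat.eq_zero_or_pos a with rfl | ha0
        · obtain rfl : R = 0 := by omega
          exact ⟨_, _, _, five_digits u u u, one_digit 1, zero g, by grind⟩
        · obtain ⟨W, hW⟩ : ∃ W, W + a = g + R := ⟨g + R - a, by omega⟩
          convert six_digits_add_lt_pow_three hg (a := a) (b := u) (D := u) (R := W) ha0
            (by omega) (by omega) (by omega) (by omega) using 1
          grind
      · obtain ⟨b, rfl⟩ : ∃ w, b = w + 1 := ⟨b - 1, by omega⟩
        obtain ⟨W, hW⟩ : ∃ W, W + (a + b * g) = g ^ 2 + R := ⟨g ^ 2 + R - (a + b * g), by grind⟩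
        convert six_digits_add_lt_pow_three hg (a := a) (b := b) (D := u) (R := W) ha
          (by omega) (by omega) (by omega) (by grind) using 1
        grind
    · obtain ⟨D, rfl⟩ : ∃ w, D = w + 1 := ⟨D - 1, by omega⟩
      obtain ⟨W, hW⟩ : ∃ W, W + (a + b * g + D * g ^ 2) = g ^ 3 + R :=
        ⟨g ^ 3 + R - (a + b * g + D * g ^ 2), by grind⟩
      rcases Nat.lt_or_ge W (g ^ 3) with hW3 | hW3
      · convert six_digits_add_lt_pow_three hg (a := a) (b := b) (D := D) (R := W) ha
          (by omega) (by omega) (by omega) hW3 using 1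
        grind
      · obtain ⟨S, rfl⟩ : ∃ S, W = g ^ 3 + S := ⟨W - g ^ 3, by omega⟩
        obtain ⟨x, y, hx, hy, rfl⟩ := exists_two_digits (n := S) (g := g) (by grind)
        convert six_digits_add_pow_three_add hg (a := a) (b := b) (D := D) (x := x) (y := y) ha
          ha' hb hD hx hy using 1
        grind
  · obtain ⟨W, rfl⟩ : ∃ W, R = W + (a + b * g + D * g ^ 2) :=
      ⟨R - (a + b * g + D * g ^ 2), by omega⟩
    convert six_digits_add_lt_pow_three hg (a := a) (b := b) (D := D) (R := W) ha ha' hb hD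
      (by omega) using 1
    ring

end IsSumOfThreePalindromes

open IsSumOfThreePalindromes in
theorem small_sum_three_palindromes (g : ℕ) (hg : 5 ≤ g) (n : ℕ)
    (h1 : 1 ≤ n) (h2 : n < g ^ 6) :
    ∃ p q r : ℕ, IsBasePalindrome g p ∧ IsBasePalindrome g q ∧ IsBasePalindrome g r ∧
      n = p + q + r := by
  change IsSumOfThreePalindromes g n
  obtain ⟨a, m, ha, hm, rfl⟩ := exists_leading_digit (k := 5) h2
  obtain ⟨b, l, hb, hl, rfl⟩ := exists_leading_digit (k := 4) hm
  obtain ⟨c, R, hc, hR, rfl⟩ := exists_leading_digit (k := 3) hl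
  rcases Nat.eq_zero_or_pos a with rfl | ha0
  · rcases Nat.eq_zero_or_pos b with rfl | hb0
    · rcases Nat.eq_zero_or_pos c with rfl | hc0
      · simpa using of_lt_pow_three hg hR
      · simpa using of_four_digits hg hc0 hc hR
    · simpa [add_assoc] using of_five_digits hg hb0 hb hc hR
  · simpa [add_assoc] using of_six_digits hg ha0 ha hb hc hR
end
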